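/- For a pure-state channel merging protocol, the converse bound holds: any (n, L/K, ε) quantum channel merging protocol for a channel N_{A→B} satisfies (1/n)[(1−√ε)log₂L − log₂K] ≤ H(N) + √ε log₂|A| + g₂(√ε), where g₂(δ) = (δ+1)log₂(δ+1) − δ log₂ δ. -/

import Mathlib

open Matrix BigOperators
open scoped Kronecker ComplexOrder

namespace QCh

variable {n m : Type*} [Fintype n] [DecidableEq n] [Fintype m] [DecidableEq m]

/-- Density matrix: positive semidefinite with unit trace. -/
def IsDensity (ρ : Matrix n n ℂ) : Prop := ρ.PosSemidef ∧ ρ.trace = 1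

/-- Pure state: density matrix that is a projection. -/
def IsPure (ρ : Matrix n n ℂ) : Prop := IsDensity ρ ∧ ρ * ρ = ρ

/-- Apply a real function to a Hermitian matrix via its spectral decomposition. -/
noncomputable def matFun (f : ℝ → ℝ) (A : Matrix n n ℂ) : Matrix n n ℂ :=
  if h : A.IsHermitian then
    (h.eigenvectorUnitary : Matrix n n ℂ) * Matrix.diagonal (fun i => (f (h.eigenvalues i) : ℂ)) *
      (star h.eigenvectorUnitary : Matrix n n ℂ)
  else 0

/-- von Neumann entropy in bits. -/
noncomputable def vnEntropy (ρ : Matrix n n ℂ) : ℝ :=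
  if h : ρ.IsHermitian then -∑ i, h.eigenvalues i * Real.logb 2 (h.eigenvalues i) else 0

/-- Base-2 matrix logarithm (on the support, via spectral calculus). -/
noncomputable def matLog2 (A : Matrix n n ℂ) : Matrix n n ℂ := matFun (Real.logb 2) A

/-- Quantum relative entropy in bits. -/
noncomputable def relEnt (ρ σ : Matrix n n ℂ) : ℝ :=
  ((ρ * (matLog2 ρ - matLog2 σ)).trace).re

/-- Partial trace over the second tensor factor. -/
noncomputable def ptR {p : Type*} [Fintype p] (M : Matrix (n × p) (n × p) ℂ) : Matrix n n ℂ :=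
  Matrix.of fun i j => ∑ k, M (i, k) (j, k)

/-- Partial trace over the first tensor factor. -/
noncomputable def ptL {p : Type*} [Fintype p] (M : Matrix (p × n) (p × n) ℂ) : Matrix n n ℂ :=
  Matrix.of fun i j => ∑ k, M (k, i) (k, j)

/-- Conditional entropy H(B|R) of a state on R ⊗ B. -/
noncomputable def condEntB {R B : Type*} [Fintype R] [DecidableEq R] [Fintype B] [DecidableEq B]
    (ω : Matrix (R × B) (R × B) ℂ) : ℝ := vnEntropy ω - vnEntropy (ptR ω)

/-- Extension id_R ⊗ N of a map N on system A, acting on a state of R ⊗ A. -/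
noncomputable def ext {R A B : Type*} [Fintype R] [DecidableEq R] [Fintype A] [DecidableEq A]
    [Fintype B] [DecidableEq B] (N : Matrix A A ℂ → Matrix B B ℂ)
    (ψ : Matrix (R × A) (R × A) ℂ) : Matrix (R × B) (R × B) ℂ :=
  Matrix.of fun p q => N (Matrix.of fun a a' => ψ (p.1, a) (q.1, a')) p.2 q.2

/-- The channel with Kraus operators K. -/
noncomputable def krausMap {A B ι : Type*} [Fintype A] [Fintype B] [Fintype ι]
    (K : ι → Matrix B A ℂ) (X : Matrix A A ℂ) : Matrix B B ℂ :=
  ∑ i, K i * X * (K i)ᴴ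

/-- Entropy of a channel: infimum of H(B|R) of the output over pure bipartite inputs,
with the reference system isomorphic to the channel input. -/
noncomputable def chEnt {A B : Type*} [Fintype A] [DecidableEq A] [Fintype B] [DecidableEq B]
    (N : Matrix A A ℂ → Matrix B B ℂ) : ℝ :=
  sInf {x | ∃ ψ : Matrix (A × A) (A × A) ℂ, IsPure ψ ∧ x = condEntB (ext N ψ)}

/-- Trace norm of a Hermitian matrix (sum of absolute values of eigenvalues). -/
noncomputable def traceNorm {A : Type*} [Fintype A] [DecidableEq A]
    (M : Matrix A A ℂ) : ℝ :=
  if h : M.IsHermitian then ∑ i, |h.eigenvalues i| else 0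

/-- The function g₂(δ) = (δ+1)log₂(δ+1) − δ log₂ δ. -/
noncomputable def g2 (δ : ℝ) : ℝ :=
  (δ + 1) * Real.logb 2 (δ + 1) - δ * Real.logb 2 δ

/-- Maximally entangled state of Schmidt rank L. -/
noncomputable def phiRank (L : ℕ) : Matrix (Fin L × Fin L) (Fin L × Fin L) ℂ :=
  ((L : ℂ))⁻¹ • Matrix.of fun p q => if p.1 = p.2 ∧ q.1 = q.2 then 1 else 0

/-- n-fold tensor power V^{⊗n} of an isometry V : A → B ⊗ E. -/
noncomputable def isoPow {A B E : Type*} [Fintype A] [Fintype B] [Fintype E]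
    (n : ℕ) (V : Matrix (B × E) A ℂ) :
    Matrix ((Fin n → B) × (Fin n → E)) (Fin n → A) ℂ :=
  Matrix.of fun be a => ∏ i, V (be.1 i, be.2 i) (a i)

/-- Ideal target of channel merging: the state
(id_{BE→B̃Ẽ}^{⊗n} ∘ (U^N)^{⊗n})(ψ_{RAⁿ}) ⊗ Φ^L, with reference R = Aⁿ. -/
noncomputable def idealOut {A B E : Type} [Fintype A] [DecidableEq A]
    [Fintype B] [DecidableEq B] [Fintype E] [DecidableEq E]
    (n L : ℕ) (V : Matrix (B × E) A ℂ)
    (ψ : Matrix ((Fin n → A) × (Fin n → A)) ((Fin n → A) × (Fin n → A)) ℂ) :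
    Matrix (((Fin n → A) × ((Fin n → B) × (Fin n → E))) × (Fin L × Fin L))
      (((Fin n → A) × ((Fin n → B) × (Fin n → E))) × (Fin L × Fin L)) ℂ :=
  (((1 : Matrix (Fin n → A) (Fin n → A) ℂ) ⊗ₖ isoPow n V) * ψ *
      ((1 : Matrix (Fin n → A) (Fin n → A) ℂ) ⊗ₖ isoPow n V)ᴴ) ⊗ₖ phiRank L

/-- Actual output of a one-way LOCC channel-merging protocol: Bob measures his systems
(Bⁿ and his half of Φ^K) with Kraus operators F i (outcome out i), communicates the
outcome to Eve, who applies the channel with Kraus operators G (out i) on her systems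
(Eⁿ and her half of Φ^K); Bob keeps his half of Φ^L, Eve receives B̃ⁿẼⁿ and her half
of Φ^L. The result is reindexed to match the ideal output. -/
noncomputable def actualOut {A B E M ι κ : Type} [Fintype A] [DecidableEq A]
    [Fintype B] [DecidableEq B] [Fintype E] [DecidableEq E]
    [Fintype M] [Fintype ι] [Fintype κ]
    (n K L : ℕ) (V : Matrix (B × E) A ℂ) (out : ι → M)
    (F : ι → Matrix (Fin L) ((Fin n → B) × Fin K) ℂ)
    (G : M → κ → Matrix (((Fin n → B) × (Fin n → E)) × Fin L) ((Fin n → E) × Fin K) ℂ)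
    (ψ : Matrix ((Fin n → A) × (Fin n → A)) ((Fin n → A) × (Fin n → A)) ℂ) :
    Matrix (((Fin n → A) × ((Fin n → B) × (Fin n → E))) × (Fin L × Fin L))
      (((Fin n → A) × ((Fin n → B) × (Fin n → E))) × (Fin L × Fin L)) ℂ :=
  Matrix.submatrix
    (∑ i, ∑ k,
      ((1 : Matrix (Fin n → A) (Fin n → A) ℂ) ⊗ₖ (F i ⊗ₖ G (out i) k)) *
        Matrix.submatrix
          ((((1 : Matrix (Fin n → A) (Fin n → A) ℂ) ⊗ₖ isoPow n V) * ψ *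
              ((1 : Matrix (Fin n → A) (Fin n → A) ℂ) ⊗ₖ isoPow n V)ᴴ) ⊗ₖ phiRank K)
          (fun t : (Fin n → A) × (((Fin n → B) × Fin K) × ((Fin n → E) × Fin K)) =>
            ((t.1, (t.2.1.1, t.2.2.1)), (t.2.1.2, t.2.2.2)))
          (fun t : (Fin n → A) × (((Fin n → B) × Fin K) × ((Fin n → E) × Fin K)) =>
            ((t.1, (t.2.1.1, t.2.2.1)), (t.2.1.2, t.2.2.2))) *
        ((1 : Matrix (Fin n → A) (Fin n → A) ℂ) ⊗ₖ (F i ⊗ₖ G (out i) k))ᴴ)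
    (fun t : ((Fin n → A) × ((Fin n → B) × (Fin n → E))) × (Fin L × Fin L) =>
      (t.1.1, (t.2.1, (t.1.2, t.2.2))))
    (fun t : ((Fin n → A) × ((Fin n → B) × (Fin n → E))) × (Fin L × Fin L) =>
      (t.1.1, (t.2.1, (t.1.2, t.2.2))))

section Aux

open Real

/-- Pointwise log-sum bound. -/
lemma D_pointwise {a b A B : ℝ} (ha : 0 ≤ a) (hb : 0 ≤ b) (hA : 0 < A) (hB : 0 < B) :
    negMulLog a + negMulLog b - negMulLog (a + b) ≤
      a * (log (A + B) - log A) + b * (log (A + B) - log B) := by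
  have hAle : log A ≤ log (A + B) := log_le_log hA (by linarith)
  have hBle : log B ≤ log (A + B) := log_le_log hB (by linarith)
  rcases ha.eq_or_lt with rfl | ha'
  · simp; exact mul_nonneg hb (by linarith)
  rcases hb.eq_or_lt with rfl | hb'
  · simp; exact mul_nonneg ha (by linarith)
  have key : ∀ x X : ℝ, 0 < x → 0 < X →
      x * (log (a + b) + log X - log x - log (A + B)) ≤ (a + b) * X / (A + B) - x := by
    intro x X hx hX
    have h1 := log_le_sub_one_of_pos (x := (a + b) * X / (x * (A + B))) (by positivity)
    rw [log_div (by positivity) (by positivity), log_mul (by positivity) (by positivity),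
      log_mul (by positivity) (by positivity)] at h1
    have h2 := mul_le_mul_of_nonneg_left h1 hx.le
    have h3 : x * ((a + b) * X / (x * (A + B)) - 1) = (a + b) * X / (A + B) - x := by
      field_simp
    rw [h3] at h2
    linarith
  have k1 := key a A ha' hA
  have k2 := key b B hb' hB
  have k3 : (a + b) * A / (A + B) + (a + b) * B / (A + B) = a + b := by field_simp
  simp only [negMulLog]
  nlinarith

/-- Log-sum inequality. -/
lemma D_sum {ι : Type*} (s : Finset ι) (a b : ι → ℝ) (ha : ∀ i ∈ s, 0 ≤ a i)
    (hb : ∀ i ∈ s, 0 ≤ b i) :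
    ∑ i ∈ s, (negMulLog (a i) + negMulLog (b i) - negMulLog (a i + b i)) ≤
      negMulLog (∑ i ∈ s, a i) + negMulLog (∑ i ∈ s, b i)
        - negMulLog (∑ i ∈ s, a i + ∑ i ∈ s, b i) := by
  rcases (Finset.sum_nonneg ha).eq_or_lt with hA | hA
  · have h0 : ∀ i ∈ s, a i = 0 := (Finset.sum_eq_zero_iff_of_nonneg ha).1 hA.symm
    rw [← hA]
    refine le_of_eq ?_
    rw [Finset.sum_congr rfl (g := fun _ => (0 : ℝ)) (fun i hi => by simp [h0 i hi])]
    simp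
  rcases (Finset.sum_nonneg hb).eq_or_lt with hB | hB
  · have h0 : ∀ i ∈ s, b i = 0 := (Finset.sum_eq_zero_iff_of_nonneg hb).1 hB.symm
    rw [← hB]
    refine le_of_eq ?_
    rw [Finset.sum_congr rfl (g := fun _ => (0 : ℝ)) (fun i hi => by simp [h0 i hi])]
    simp
  refine (Finset.sum_le_sum fun i hi => D_pointwise (ha i hi) (hb i hi) hA hB).trans ?_
  rw [Finset.sum_add_distrib, ← Finset.sum_mul, ← Finset.sum_mul]
  simp only [negMulLog]
  linarith

/-- Entropy (nats) as a function of the roots of the characteristic polynomial. -/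
noncomputable def S0 {ι : Type*} [Fintype ι] [DecidableEq ι] (M : Matrix ι ι ℂ) : ℝ :=
  (M.charpoly.roots.map (fun z => negMulLog z.re)).sum

/-- Homogeneous extension of the entropy. -/
noncomputable def St {ι : Type*} [Fintype ι] [DecidableEq ι] (M : Matrix ι ι ℂ) : ℝ :=
  S0 M - negMulLog M.trace.re

lemma S0_hermitian {ι : Type*} [Fintype ι] [DecidableEq ι] {M : Matrix ι ι ℂ}
    (h : M.IsHermitian) : S0 M = ∑ i, negMulLog (h.eigenvalues i) := by
  rw [S0, h.roots_charpoly_eq_eigenvalues, Multiset.map_map]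
  simp

lemma vnEntropy_eq {ι : Type*} [Fintype ι] [DecidableEq ι] {M : Matrix ι ι ℂ}
    (h : M.IsHermitian) : vnEntropy M = S0 M / log 2 := by
  rw [S0_hermitian h, vnEntropy, dif_pos h, Finset.sum_div, ← Finset.sum_neg_distrib]
  refine Finset.sum_congr rfl fun i _ => ?_
  simp only [negMulLog, logb]
  ring

lemma S0_mul_comm {ι κ : Type*} [Fintype ι] [DecidableEq ι] [Fintype κ] [DecidableEq κ]
    (P : Matrix ι κ ℂ) (Q : Matrix κ ι ℂ) : S0 (P * Q) = S0 (Q * P) := by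
  have h := Matrix.charpoly_mul_comm' P Q
  have h2 := congrArg Polynomial.roots h
  rw [Polynomial.roots_mul (mul_ne_zero (pow_ne_zero _ Polynomial.X_ne_zero)
      (Matrix.charpoly_monic _).ne_zero),
    Polynomial.roots_mul (mul_ne_zero (pow_ne_zero _ Polynomial.X_ne_zero)
      (Matrix.charpoly_monic _).ne_zero)] at h2
  have h3 := congrArg (fun m => (Multiset.map (fun z : ℂ => negMulLog z.re) m).sum) h2
  simpa [S0, Multiset.nsmul_singleton] using h3

lemma St_mul_comm {ι κ : Type*} [Fintype ι] [DecidableEq ι] [Fintype κ] [DecidableEq κ]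
    (P : Matrix ι κ ℂ) (Q : Matrix κ ι ℂ) : St (P * Q) = St (Q * P) := by
  rw [St, St, S0_mul_comm, Matrix.trace_mul_comm]

lemma S0_diagonal {ι : Type*} [Fintype ι] [DecidableEq ι] (d : ι → ℝ) :
    S0 (Matrix.diagonal (fun i => (d i : ℂ))) = ∑ i, negMulLog (d i) := by
  rw [S0, Matrix.charpoly_diagonal, Polynomial.roots_prod]
  · simp [Polynomial.roots_X_sub_C]
  · exact Finset.prod_ne_zero_iff.2 fun i _ => Polynomial.X_sub_C_ne_zero _

lemma S0_conj {ι κ : Type*} [Fintype ι] [DecidableEq ι] [Fintype κ] [DecidableEq κ]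
    (U : Matrix κ ι ℂ) (hU : Uᴴ * U = 1) (d : ι → ℝ) :
    S0 (U * Matrix.diagonal (fun i => (d i : ℂ)) * Uᴴ) = ∑ i, negMulLog (d i) := by
  rw [S0_mul_comm, ← Matrix.mul_assoc, hU, Matrix.one_mul, S0_diagonal]

lemma S0_submatrix {ι κ : Type*} [Fintype ι] [DecidableEq ι] [Fintype κ] [DecidableEq κ]
    (e : κ ≃ ι) (M : Matrix ι ι ℂ) : S0 (M.submatrix e e) = S0 M := by
  have := Matrix.charpoly_reindex e.symm M
  rw [Matrix.reindex_apply] at this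
  rw [S0, S0, ← this]; rfl

lemma spectral {ι : Type*} [Fintype ι] [DecidableEq ι] {M : Matrix ι ι ℂ}
    (h : M.IsHermitian) : ∃ U : Matrix ι ι ℂ, Uᴴ * U = 1 ∧ U * Uᴴ = 1 ∧
      M = U * Matrix.diagonal (fun i => (h.eigenvalues i : ℂ)) * Uᴴ := by
  refine ⟨h.eigenvectorUnitary, ?_, ?_, ?_⟩
  · exact Unitary.coe_star_mul_self _
  · exact Unitary.coe_mul_star_self _
  · conv_lhs => rw [h.spectral_theorem]
    rfl

/-- Peierls-type inequality. -/
lemma S0_le_diag {ι : Type*} [Fintype ι] [DecidableEq ι] {M : Matrix ι ι ℂ}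
    (h : M.PosSemidef) : S0 M ≤ ∑ i, negMulLog (M i i).re := by
  obtain ⟨U, hU1, hU2, hM⟩ := spectral h.1
  have hd : ∀ i, (M i i).re = ∑ j, Complex.normSq (U i j) * h.1.eigenvalues j := by
    intro i
    conv_lhs => rw [hM]
    rw [Matrix.mul_apply, Complex.re_sum]
    simp only [Matrix.mul_diagonal, Matrix.conjTranspose_apply]
    refine Finset.sum_congr rfl fun j _ => ?_
    simp [Complex.normSq_apply]
    ring
  have hrow : ∀ i, ∑ j, Complex.normSq (U i j) = 1 := by
    intro i
    have := congrArg Complex.re (congrFun (congrFun hU2 i) i)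
    simp only [Matrix.mul_apply, Matrix.conjTranspose_apply, Complex.re_sum,
      Matrix.one_apply_eq, Complex.one_re] at this
    rw [← this]
    refine Finset.sum_congr rfl fun j _ => ?_
    simp [Complex.normSq_apply]
  have hcol : ∀ j, ∑ i, Complex.normSq (U i j) = 1 := by
    intro j
    have := congrArg Complex.re (congrFun (congrFun hU1 j) j)
    simp only [Matrix.mul_apply, Matrix.conjTranspose_apply, Complex.re_sum,
      Matrix.one_apply_eq, Complex.one_re] at this
    rw [← this]
    refine Finset.sum_congr rfl fun j _ => ?_
    simp [Complex.normSq_apply]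
  rw [S0_hermitian h.1]
  calc ∑ j, negMulLog (h.1.eigenvalues j)
      = ∑ j, (∑ i, Complex.normSq (U i j)) * negMulLog (h.1.eigenvalues j) := by simp [hcol]
    _ = ∑ i, ∑ j, Complex.normSq (U i j) * negMulLog (h.1.eigenvalues j) := by
        simp_rw [Finset.sum_mul]; exact Finset.sum_comm
    _ ≤ ∑ i, negMulLog (M i i).re := by
        refine Finset.sum_le_sum fun i _ => ?_
        rw [hd i]
        have := concaveOn_negMulLog.le_map_sum (t := Finset.univ)
          (w := fun j => Complex.normSq (U i j)) (p := h.1.eigenvalues)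
          (fun j _ => Complex.normSq_nonneg _) (hrow i) (fun j _ => h.eigenvalues_nonneg j)
        simpa using this

lemma trace_re_nonneg {ι : Type*} [Fintype ι] [DecidableEq ι] {M : Matrix ι ι ℂ}
    (h : M.PosSemidef) : 0 ≤ M.trace.re :=
  (Complex.le_def.1 h.trace_nonneg).1

lemma diag_re_nonneg {ι : Type*} [Fintype ι] [DecidableEq ι] {M : Matrix ι ι ℂ}
    (h : M.PosSemidef) (i : ι) : 0 ≤ (M i i).re :=
  (Complex.le_def.1 (h.diag_nonneg (i := i))).1

lemma St_add_le {ι : Type*} [Fintype ι] [DecidableEq ι] {P Q : Matrix ι ι ℂ}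
    (hP : P.PosSemidef) (hQ : Q.PosSemidef) : St P + St Q ≤ St (P + Q) := by
  have hPQ := hP.add hQ
  obtain ⟨U, hU1, hU2, hM⟩ := spectral hPQ.1
  set lam := hPQ.1.eigenvalues with hlam
  have hP' : (Uᴴ * P * U).PosSemidef := hP.conjTranspose_mul_mul_same U
  have hQ' : (Uᴴ * Q * U).PosSemidef := hQ.conjTranspose_mul_mul_same U
  have hS : ∀ X : Matrix ι ι ℂ, S0 (Uᴴ * X * U) = S0 X := by
    intro X
    rw [S0_mul_comm, ← Matrix.mul_assoc, hU2, Matrix.one_mul]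
  have hT : ∀ X : Matrix ι ι ℂ, X.trace.re = ∑ i, ((Uᴴ * X * U) i i).re := by
    intro X
    have : X.trace = (Uᴴ * X * U).trace := by
      rw [Matrix.trace_mul_comm, ← Matrix.mul_assoc, hU2, Matrix.one_mul]
    rw [this, Matrix.trace, Complex.re_sum]; rfl
  have hD : ∀ i, lam i = ((Uᴴ * P * U) i i).re + ((Uᴴ * Q * U) i i).re := by
    intro i
    have h1 : Uᴴ * P * U + Uᴴ * Q * U = Matrix.diagonal (fun i => (lam i : ℂ)) := by
      rw [← Matrix.add_mul, ← Matrix.mul_add, hM, ← Matrix.mul_assoc, ← Matrix.mul_assoc, hU1,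
        Matrix.one_mul, Matrix.mul_assoc, hU1, Matrix.mul_one]
    have h2 := congrArg Complex.re (congrFun (congrFun h1 i) i)
    simpa using h2.symm
  have e1 := S0_le_diag hP'
  have e2 := S0_le_diag hQ'
  rw [hS] at e1 e2
  have e3 := D_sum Finset.univ (fun i => ((Uᴴ * P * U) i i).re) (fun i => ((Uᴴ * Q * U) i i).re)
    (fun i _ => diag_re_nonneg hP' i) (fun i _ => diag_re_nonneg hQ' i)
  rw [← hT, ← hT] at e3
  simp only [Finset.sum_sub_distrib, Finset.sum_add_distrib] at e3
  have e4 : S0 (P + Q) = ∑ i, negMulLog (((Uᴴ * P * U) i i).re + ((Uᴴ * Q * U) i i).re) := by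
    rw [S0_hermitian hPQ.1]
    exact Finset.sum_congr rfl fun i _ => by rw [← hD]
  simp only [St, Matrix.trace_add, Complex.add_re]
  linarith

lemma St_zero {ι : Type*} [Fintype ι] [DecidableEq ι] : St (0 : Matrix ι ι ℂ) = 0 := by
  have := S0_diagonal (ι := ι) (fun _ => 0)
  simp only [Complex.ofReal_zero, negMulLog_zero, Finset.sum_const_zero, Matrix.diagonal_zero] at this
  simp [St, this]

lemma St_sum_le {ι κ : Type*} [Fintype ι] [DecidableEq ι] (s : Finset κ)
    (P : κ → Matrix ι ι ℂ) (hP : ∀ k, (P k).PosSemidef) :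
    ∑ k ∈ s, St (P k) ≤ St (∑ k ∈ s, P k) := by
  classical
  induction s using Finset.induction_on with
  | empty => simp [St_zero]
  | insert a s ha ih =>
    rw [Finset.sum_insert ha, Finset.sum_insert ha]
    refine le_trans ?_ (St_add_le (hP a) (Matrix.posSemidef_sum s fun k _ => hP k))
    linarith

/-- A PSD matrix is `W * Wᴴ` with `Wᴴ * W` diagonal carrying the eigenvalues. -/
lemma exists_sqrt {ι : Type*} [Fintype ι] [DecidableEq ι] {M : Matrix ι ι ℂ}
    (h : M.PosSemidef) : ∃ W : Matrix ι ι ℂ, M = W * Wᴴ ∧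
      Wᴴ * W = Matrix.diagonal (fun i => (h.1.eigenvalues i : ℂ)) := by
  obtain ⟨U, hU1, hU2, hM⟩ := spectral h.1
  have hs : Matrix.diagonal (fun i => ((√(h.1.eigenvalues i) : ℝ) : ℂ)) *
      Matrix.diagonal (fun i => ((√(h.1.eigenvalues i) : ℝ) : ℂ)) =
      Matrix.diagonal (fun i => (h.1.eigenvalues i : ℂ)) := by
    rw [Matrix.diagonal_mul_diagonal]
    congr 1; funext i
    rw [← Complex.ofReal_mul, Real.mul_self_sqrt (h.eigenvalues_nonneg i)]
  have hc : (Matrix.diagonal (fun i => ((√(h.1.eigenvalues i) : ℝ) : ℂ)))ᴴ =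
      Matrix.diagonal (fun i => ((√(h.1.eigenvalues i) : ℝ) : ℂ)) := by
    rw [Matrix.diagonal_conjTranspose]
    congr 1; funext i; simp
  refine ⟨U * Matrix.diagonal (fun i => ((√(h.1.eigenvalues i) : ℝ) : ℂ)), ?_, ?_⟩
  · rw [Matrix.conjTranspose_mul, hc, Matrix.mul_assoc, ← Matrix.mul_assoc (Matrix.diagonal _), hs,
      ← Matrix.mul_assoc]
    exact hM
  · rw [Matrix.conjTranspose_mul, hc, Matrix.mul_assoc, ← Matrix.mul_assoc Uᴴ, hU1,
      Matrix.one_mul, hs]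

lemma S0_add_le {ι : Type*} [Fintype ι] [DecidableEq ι] {P Q : Matrix ι ι ℂ}
    (hP : P.PosSemidef) (hQ : Q.PosSemidef) : S0 (P + Q) ≤ S0 P + S0 Q := by
  obtain ⟨X, hX1, hX2⟩ := exists_sqrt hP
  obtain ⟨Y, hY1, hY2⟩ := exists_sqrt hQ
  have h1 : P + Q = Matrix.fromCols X Y * (Matrix.fromCols X Y)ᴴ := by
    rw [Matrix.conjTranspose_fromCols_eq_fromRows_conjTranspose, Matrix.fromCols_mul_fromRows,
      ← hX1, ← hY1]
  rw [h1, S0_mul_comm]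
  refine (S0_le_diag (Matrix.posSemidef_conjTranspose_mul_self _)).trans (le_of_eq ?_)
  rw [Matrix.conjTranspose_fromCols_eq_fromRows_conjTranspose, Matrix.fromRows_mul_fromCols,
    Fintype.sum_sum_type, S0_hermitian hP.1, S0_hermitian hQ.1]
  simp [hX2, hY2]

lemma St_nonneg {ι : Type*} [Fintype ι] [DecidableEq ι] {M : Matrix ι ι ℂ}
    (h : M.PosSemidef) : 0 ≤ St M := by
  have ht : M.trace.re = ∑ i, h.1.eigenvalues i := by
    rw [h.1.trace_eq_sum_eigenvalues]; simp
  rw [St, S0_hermitian h.1, ht, sub_nonneg]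
  simp only [negMulLog]
  rw [neg_mul, Finset.sum_mul, ← Finset.sum_neg_distrib]
  refine Finset.sum_le_sum fun i _ => ?_
  rcases (h.eigenvalues_nonneg i).eq_or_lt with h0 | h0
  · simp [← h0]
  · have h1 : h.1.eigenvalues i ≤ ∑ i, h.1.eigenvalues i :=
      Finset.single_le_sum (f := h.1.eigenvalues) (fun i _ => h.eigenvalues_nonneg i) (Finset.mem_univ i)
    have := mul_le_mul_of_nonneg_left (log_le_log h0 h1) h0.le
    linarith

lemma St_le {ι : Type*} [Fintype ι] [DecidableEq ι] {M : Matrix ι ι ℂ}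
    (h : M.PosSemidef) : St M ≤ M.trace.re * log (Fintype.card ι) := by
  rcases isEmpty_or_nonempty ι with hι | hι
  · have : M = 0 := Subsingleton.elim _ _
    rw [this, St_zero]; simp
  have ht : M.trace.re = ∑ i, h.1.eigenvalues i := by
    rw [h.1.trace_eq_sum_eigenvalues]; simp
  rw [St, S0_hermitian h.1, ht]
  set t := ∑ i, h.1.eigenvalues i with htd
  have hc : (0 : ℝ) < Fintype.card ι := by exact_mod_cast Fintype.card_pos
  have hj := concaveOn_negMulLog.le_map_sum (t := Finset.univ)
          (w := fun _ : ι => (Fintype.card ι : ℝ)⁻¹) (p := h.1.eigenvalues)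
          (fun j _ => by positivity) (by simp) (fun j _ => h.eigenvalues_nonneg j)
  simp only [smul_eq_mul, ← Finset.mul_sum] at hj
  rw [← htd, negMulLog_mul] at hj
  have h2 : negMulLog ((Fintype.card ι : ℝ)⁻¹) = (Fintype.card ι : ℝ)⁻¹ * log (Fintype.card ι) := by
    simp [negMulLog]
  rw [h2] at hj
  have h3 := mul_le_mul_of_nonneg_left hj hc.le
  have h4 : (Fintype.card ι : ℝ) * (t * ((Fintype.card ι : ℝ)⁻¹ * log (Fintype.card ι)) +
      (Fintype.card ι : ℝ)⁻¹ * negMulLog t) = t * log (Fintype.card ι) + negMulLog t := by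
    field_simp
  rw [h4, mul_inv_cancel_left₀ hc.ne'] at h3
  linarith

lemma St_smul {ι : Type*} [Fintype ι] [DecidableEq ι] {M : Matrix ι ι ℂ}
    (h : M.IsHermitian) (c : ℝ) : St ((c : ℂ) • M) = c * St M := by
  obtain ⟨U, hU1, hU2, hM⟩ := spectral h
  have ht : M.trace.re = ∑ i, h.eigenvalues i := by
    rw [h.trace_eq_sum_eigenvalues]; simp
  have h1 : (c : ℂ) • M =
      U * Matrix.diagonal (fun i => ((c * h.eigenvalues i : ℝ) : ℂ)) * Uᴴ := by
    conv_lhs => rw [hM]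
    rw [← Matrix.smul_mul, ← Matrix.mul_smul, ← Matrix.diagonal_smul]
    congr 3; funext i; simp
  have h2 : ((c : ℂ) • M).trace.re = c * M.trace.re := by simp [Matrix.trace_smul]
  rw [St, St, h2, h1, S0_conj U hU1, S0_hermitian h, ht]
  simp only [negMulLog_mul, Finset.sum_add_distrib, ← Finset.mul_sum, ← Finset.sum_mul]
  ring

lemma locc_step1 {X Y Y' κ : Type*} [Fintype X] [Fintype Y] [DecidableEq Y]
    [Fintype Y'] [Fintype κ] (T : Matrix X Y ℂ)
    (G : κ → Matrix Y' Y ℂ) (hG : ∑ k, (G k)ᴴ * G k = 1) :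
    ∑ k, (T * (G k)ᵀ) * (T * (G k)ᵀ)ᴴ = T * Tᴴ := by
  have h1 : ∑ k, (G k)ᵀ * ((G k)ᵀ)ᴴ = 1 := by
    have := congrArg Matrix.transpose hG
    rw [Matrix.transpose_sum, Matrix.transpose_one] at this
    rw [← this]
    refine Finset.sum_congr rfl fun k _ => ?_
    rw [Matrix.transpose_mul]
    rfl
  calc ∑ k, (T * (G k)ᵀ) * (T * (G k)ᵀ)ᴴ
      = ∑ k, T * ((G k)ᵀ * ((G k)ᵀ)ᴴ) * Tᴴ := by
        refine Finset.sum_congr rfl fun k _ => ?_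
        rw [Matrix.conjTranspose_mul T]
        simp only [Matrix.mul_assoc]
    _ = _ := by rw [← Matrix.sum_mul, ← Matrix.mul_sum, h1, Matrix.mul_one]

lemma locc_step2 {X Y X' ι : Type*} [Fintype X] [DecidableEq X] [Fintype Y]
    [Fintype X'] [Fintype ι] (T : Matrix X Y ℂ)
    (P : ι → Matrix X' X ℂ) (hP : ∑ i, (P i)ᴴ * P i = 1) :
    ∑ i, (P i * T)ᴴ * (P i * T) = Tᴴ * T := by
  calc ∑ i, (P i * T)ᴴ * (P i * T) = ∑ i, Tᴴ * ((P i)ᴴ * P i) * T := by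
        refine Finset.sum_congr rfl fun k _ => ?_
        rw [Matrix.conjTranspose_mul]
        simp only [Matrix.mul_assoc]
    _ = _ := by rw [← Matrix.sum_mul, ← Matrix.mul_sum, hP, Matrix.mul_one]

/-- Monotonicity of average entanglement under one-way LOCC. -/
lemma locc_mono {X Y X' Y' ι κ : Type*} [Fintype X] [DecidableEq X] [Fintype Y] [DecidableEq Y]
    [Fintype X'] [DecidableEq X'] [Fintype Y'] [Fintype ι] [Fintype κ]
    (T : Matrix X Y ℂ) (P : ι → Matrix X' X ℂ) (hP : ∑ i, (P i)ᴴ * P i = 1)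
    (G : ι → κ → Matrix Y' Y ℂ) (hG : ∀ i, ∑ k, (G i k)ᴴ * G i k = 1) :
    ∑ i, ∑ k, St ((P i * T * (G i k)ᵀ) * (P i * T * (G i k)ᵀ)ᴴ) ≤ St (T * Tᴴ) := by
  have hstep : ∀ i, ∑ k, St ((P i * T * (G i k)ᵀ) * (P i * T * (G i k)ᵀ)ᴴ) ≤
      St ((P i * T)ᴴ * (P i * T)) := by
    intro i
    refine (St_sum_le Finset.univ _ fun k => Matrix.posSemidef_self_mul_conjTranspose _).trans ?_
    rw [St_mul_comm (P i * T)ᴴ, locc_step1 _ _ (hG i)]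
  refine (Finset.sum_le_sum fun i _ => hstep i).trans ?_
  refine (St_sum_le Finset.univ _ fun k => Matrix.posSemidef_conjTranspose_mul_self _).trans ?_
  rw [St_mul_comm T, locc_step2 _ _ hP]

/-- The protocol preserves the trace. -/
lemma locc_trace {X Y X' Y' ι κ : Type*} [Fintype X] [DecidableEq X] [Fintype Y] [DecidableEq Y]
    [Fintype X'] [Fintype Y'] [Fintype ι] [Fintype κ]
    (T : Matrix X Y ℂ) (P : ι → Matrix X' X ℂ) (hP : ∑ i, (P i)ᴴ * P i = 1)
    (G : ι → κ → Matrix Y' Y ℂ) (hG : ∀ i, ∑ k, (G i k)ᴴ * G i k = 1) :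
    ∑ i, ∑ k, ((P i * T * (G i k)ᵀ) * (P i * T * (G i k)ᵀ)ᴴ).trace = (T * Tᴴ).trace := by
  rw [Matrix.trace_mul_comm, ← locc_step2 _ _ hP, Matrix.trace_sum]
  refine Finset.sum_congr rfl fun i _ => ?_
  rw [← Matrix.trace_sum, locc_step1 _ _ (hG i), Matrix.trace_mul_comm]

lemma jordan {ι : Type*} [Fintype ι] [DecidableEq ι] {M : Matrix ι ι ℂ}
    (h : M.IsHermitian) : ∃ P N : Matrix ι ι ℂ, P.PosSemidef ∧ N.PosSemidef ∧ M = P - N ∧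
      P.trace.re + N.trace.re = traceNorm M := by
  obtain ⟨U, hU1, hU2, hM⟩ := spectral h
  have hps : ∀ d : ι → ℝ, (∀ i, 0 ≤ d i) →
      (U * Matrix.diagonal (fun i => (d i : ℂ)) * Uᴴ).PosSemidef := by
    intro d hd
    refine Matrix.PosSemidef.mul_mul_conjTranspose_same ?_ U
    exact Matrix.PosSemidef.diagonal fun i => by simpa using hd i
  have htr : ∀ d : ι → ℝ,
      (U * Matrix.diagonal (fun i => (d i : ℂ)) * Uᴴ).trace.re = ∑ i, d i := by
    intro d
    rw [Matrix.trace_mul_comm, ← Matrix.mul_assoc, hU1, Matrix.one_mul]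
    simp [Matrix.trace]
  refine ⟨_, _, hps (fun i => max (h.eigenvalues i) 0) (fun i => le_max_right _ _),
    hps (fun i => max (-h.eigenvalues i) 0) (fun i => le_max_right _ _), ?_, ?_⟩
  · conv_lhs => rw [hM]
    rw [← Matrix.sub_mul, ← Matrix.mul_sub, Matrix.diagonal_sub]
    congr 3; funext i
    rw [← Complex.ofReal_sub]
    congr 1
    rcases le_total (h.eigenvalues i) 0 with h0 | h0
    · rw [max_eq_right h0, max_eq_left (by linarith)]; ring
    · rw [max_eq_left h0, max_eq_right (by linarith)]; ring
  · rw [htr, htr, traceNorm, dif_pos h, ← Finset.sum_add_distrib]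
    refine Finset.sum_congr rfl fun i _ => ?_
    rcases le_total (h.eigenvalues i) 0 with h0 | h0
    · rw [max_eq_right h0, max_eq_left (by linarith), abs_of_nonpos h0]; ring
    · rw [max_eq_left h0, max_eq_right (by linarith), abs_of_nonneg h0]; ring

/-- `g` in nats. -/
noncomputable def gN (δ : ℝ) : ℝ := negMulLog δ - negMulLog (1 + δ)

lemma gN_mono {a b : ℝ} (ha : 0 ≤ a) (hab : a ≤ b) : gN a ≤ gN b := by
  have := D_sum (Finset.univ : Finset (Fin 2)) ![1, 0] ![a, b - a]
    (by intro i _; fin_cases i <;> simp) (by intro i _; fin_cases i <;> simp <;> linarith)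
  simp [Fin.sum_univ_two] at this
  simp only [gN]
  linarith

lemma gN_nonneg {a : ℝ} (ha : 0 ≤ a) : 0 ≤ gN a := by
  have := gN_mono le_rfl ha
  simpa [gN] using this

lemma afw {X κ : Type*} [Fintype X] [DecidableEq X] [Fintype κ]
    (w w' : κ → Matrix X X ℂ) (hw : ∀ x, (w x).PosSemidef) (hw' : ∀ x, (w' x).PosSemidef)
    (ht : ∑ x, (w x).trace.re = 1) (ht' : ∑ x, (w' x).trace.re = 1) (δ : ℝ)
    (hδ : ∑ x, traceNorm (w x - w' x) ≤ 2 * δ) :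
    ∑ x, St (w' x) ≤ ∑ x, St (w x) + δ * log (Fintype.card X) + gN δ := by
  choose P N hP hN hPN htr using fun x => jordan ((hw x).1.sub (hw' x).1)
  have hsum : ∑ x, (P x).trace.re = ∑ x, (N x).trace.re := by
    have h1 : ∀ x, (w x).trace.re - (w' x).trace.re = (P x).trace.re - (N x).trace.re := by
      intro x
      have := congrArg (fun M => (Matrix.trace M).re) (hPN x)
      simpa [Matrix.trace_sub] using this
    have h2 := Finset.sum_congr (s₁ := Finset.univ) rfl fun x _ => h1 x
    rw [Finset.sum_sub_distrib, Finset.sum_sub_distrib, ht, ht'] at h2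
    linarith
  have hle : ∑ x, (N x).trace.re ≤ δ := by
    simp_rw [← htr] at hδ
    rw [Finset.sum_add_distrib, hsum] at hδ
    linarith
  have hN0 : 0 ≤ ∑ x, (N x).trace.re := Finset.sum_nonneg fun x _ => trace_re_nonneg (hN x)
  have hx : ∀ x, St (w' x) ≤ St (w x) + (N x).trace.re * log (Fintype.card X) +
      (negMulLog (w x).trace.re + negMulLog (N x).trace.re
        - negMulLog ((w x).trace.re + (N x).trace.re)) := by
    intro x
    have e : w' x + P x = w x + N x := by
      have := hPN x
      rw [sub_eq_sub_iff_add_eq_add] at this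
      rw [this, add_comm]
    have h1 := St_add_le (hw' x) (hP x)
    have h2 := St_nonneg (hP x)
    have h3 := S0_add_le (hw x) (hN x)
    have h4 := St_le (hN x)
    rw [e] at h1
    simp only [St, Matrix.trace_add, Complex.add_re] at *
    linarith
  refine (Finset.sum_le_sum fun x _ => hx x).trans ?_
  rw [Finset.sum_add_distrib, Finset.sum_add_distrib, ← Finset.sum_mul]
  have h5 := D_sum Finset.univ (fun x => (w x).trace.re) (fun x => (N x).trace.re)
    (fun x _ => trace_re_nonneg (hw x)) (fun x _ => trace_re_nonneg (hN x))
  rw [ht, negMulLog_one] at h5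
  have h6 := gN_mono hN0 hle
  have h7 : (0 : ℝ) ≤ log (Fintype.card X) := log_natCast_nonneg _
  have h8 := mul_le_mul_of_nonneg_right hle h7
  simp only [gN] at *
  linarith

/-- Squared Frobenius norm. -/
noncomputable def fro {X Y : Type*} [Fintype X] [Fintype Y] (Z : Matrix X Y ℂ) : ℝ :=
  ∑ i, ∑ j, ‖Z i j‖ ^ 2

lemma fro_eq {X Y : Type*} [Fintype X] [Fintype Y] (Z : Matrix X Y ℂ) :
    fro Z = (Z * Zᴴ).trace.re := by
  simp only [fro, Matrix.trace, Matrix.diag_apply, Matrix.mul_apply, Complex.re_sum]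
  refine Finset.sum_congr rfl fun i _ => Finset.sum_congr rfl fun j _ => ?_
  rw [← Complex.normSq_eq_norm_sq]
  simp [Complex.normSq_apply]

lemma fro_nonneg {X Y : Type*} [Fintype X] [Fintype Y] (Z : Matrix X Y ℂ) : 0 ≤ fro Z :=
  Finset.sum_nonneg fun _ _ => Finset.sum_nonneg fun _ _ => by positivity

lemma abs_normsq_sub (u w : ℂ) : |‖u‖ ^ 2 - ‖w‖ ^ 2| ≤ ‖u - w‖ * ‖u + w‖ := by
  have h : ‖u‖ ^ 2 - ‖w‖ ^ 2 = ((u - w) * star (u + w)).re := by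
    rw [← Complex.normSq_eq_norm_sq, ← Complex.normSq_eq_norm_sq]
    simp [Complex.normSq_apply]
    ring
  rw [h]
  refine (Complex.abs_re_le_norm _).trans ?_
  rw [norm_mul, norm_star]

lemma traceNorm_le {X Y : Type*} [Fintype X] [DecidableEq X] [Fintype Y]
    (U W : Matrix X Y ℂ) :
    traceNorm (U * Uᴴ - W * Wᴴ) ≤ √(fro (U - W)) * √(fro (U + W)) := by
  have hH : (U * Uᴴ - W * Wᴴ).IsHermitian :=
    (Matrix.posSemidef_self_mul_conjTranspose U).1.sub (Matrix.posSemidef_self_mul_conjTranspose W).1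
  obtain ⟨E, hE1, hE2, hM⟩ := spectral hH
  rw [traceNorm, dif_pos hH]
  set lam := hH.eigenvalues with hlam
  have hfro : ∀ Z : Matrix X Y ℂ, fro (Eᴴ * Z) = fro Z := by
    intro Z
    rw [fro_eq, fro_eq, Matrix.trace_mul_comm, Matrix.conjTranspose_mul,
      Matrix.conjTranspose_conjTranspose, Matrix.mul_assoc, ← Matrix.mul_assoc E, hE2,
      Matrix.one_mul, Matrix.trace_mul_comm]
  have hl : ∀ i, lam i = ∑ j, (‖(Eᴴ * U) i j‖ ^ 2 - ‖(Eᴴ * W) i j‖ ^ 2) := by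
    intro i
    have h1 : (Eᴴ * U) * (Eᴴ * U)ᴴ - (Eᴴ * W) * (Eᴴ * W)ᴴ =
        Matrix.diagonal (fun i => (lam i : ℂ)) := by
      have : (Eᴴ * U) * (Eᴴ * U)ᴴ - (Eᴴ * W) * (Eᴴ * W)ᴴ = Eᴴ * (U * Uᴴ - W * Wᴴ) * E := by
        rw [Matrix.conjTranspose_mul, Matrix.conjTranspose_mul, Matrix.conjTranspose_conjTranspose,
          Matrix.mul_sub, Matrix.sub_mul]
        simp only [Matrix.mul_assoc]
      rw [this, hM, ← Matrix.mul_assoc, ← Matrix.mul_assoc, hE1, Matrix.one_mul,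
        Matrix.mul_assoc, hE1, Matrix.mul_one]
    have h2 := congrArg Complex.re (congrFun (congrFun h1 i) i)
    simp only [Matrix.sub_apply, Matrix.diagonal_apply_eq, Complex.ofReal_re, Complex.sub_re] at h2
    rw [← h2, Finset.sum_sub_distrib, Matrix.mul_apply, Matrix.mul_apply, Complex.re_sum,
      Complex.re_sum]
    congr 1 <;>
    · refine Finset.sum_congr rfl fun j _ => ?_
      rw [← Complex.normSq_eq_norm_sq]
      simp [Complex.normSq_apply]
  rw [← hfro (U - W), ← hfro (U + W), Matrix.mul_sub, Matrix.mul_add]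
  calc ∑ i, |lam i| ≤ ∑ i, ∑ j, ‖(Eᴴ * U - Eᴴ * W) i j‖ * ‖(Eᴴ * U + Eᴴ * W) i j‖ := by
        refine Finset.sum_le_sum fun i _ => ?_
        rw [hl i]
        refine (Finset.abs_sum_le_sum_abs _ _).trans (Finset.sum_le_sum fun j _ => ?_)
        exact abs_normsq_sub _ _
    _ ≤ _ := by
        simp only [fro, ← Fintype.sum_prod_type']
        exact Real.sum_mul_le_sqrt_mul_sqrt Finset.univ
          (fun p : X × Y => ‖(Eᴴ * U - Eᴴ * W) p.1 p.2‖)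
          (fun p : X × Y => ‖(Eᴴ * U + Eᴴ * W) p.1 p.2‖)

lemma fro_add_smul {X Y : Type*} [Fintype X] [Fintype Y] (S T : Matrix X Y ℂ) (z : ℂ) :
    fro (S + z • T) = fro S + ‖z‖ ^ 2 * fro T + 2 * (star z * (Tᴴ * S).trace).re := by
  have h : (Tᴴ * S).trace = ∑ i, ∑ j, star (T i j) * S i j := by
    rw [Matrix.trace, Finset.sum_comm]
    simp [Matrix.mul_apply]
  rw [h]
  simp only [fro, Finset.mul_sum, Complex.re_sum, ← Finset.sum_add_distrib]
  refine Finset.sum_congr rfl fun i _ => Finset.sum_congr rfl fun j _ => ?_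
  simp only [← Complex.normSq_eq_norm_sq]
  simp [Complex.normSq_apply]
  ring

/-- Continuity bound: the average entanglement of a pure-state ensemble with high fidelity to a
pure state. -/
lemma continuity_bound {X Y κ : Type*} [Fintype X] [DecidableEq X] [Fintype Y] [Fintype κ]
    (T : Matrix X Y ℂ) (Tx : κ → Matrix X Y ℂ) (hT : fro T = 1) (hTx : ∑ x, fro (Tx x) = 1)
    (ε : ℝ) (hε1 : ε ≤ 1)
    (hF : 1 - ε ≤ ∑ x, ‖(Tᴴ * Tx x).trace‖ ^ 2) :
    S0 (T * Tᴴ) ≤ ∑ x, St (Tx x * (Tx x)ᴴ) + √ε * log (Fintype.card X) + gN √ε := by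
  set c : κ → ℂ := fun x => (Tᴴ * Tx x).trace with hc
  set f := ∑ x, ‖c x‖ ^ 2 with hf
  have hf0 : 0 ≤ f := Finset.sum_nonneg fun _ _ => by positivity
  have hps := Matrix.posSemidef_self_mul_conjTranspose T
  have hSS : S0 (T * Tᴴ) = St (T * Tᴴ) := by
    rw [St, ← fro_eq, hT]; simp
  rw [hSS]
  rcases hf0.eq_or_lt with hfz | hfp
  · have hε : ε = 1 := by
      have : 1 - ε ≤ f := hF
      linarith
    have h1 := St_le hps
    rw [← fro_eq, hT] at h1
    have h2 : 0 ≤ ∑ x, St (Tx x * (Tx x)ᴴ) := Finset.sum_nonneg fun x _ =>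
      St_nonneg (Matrix.posSemidef_self_mul_conjTranspose _)
    have h3 : 0 ≤ gN √ε := gN_nonneg (Real.sqrt_nonneg _)
    rw [hε, Real.sqrt_one] at *
    linarith
  set s := √f with hs
  have hsp : 0 < s := Real.sqrt_pos.2 hfp
  have hss : s * s = f := Real.mul_self_sqrt hf0
  set ξ : κ → ℂ := fun x => c x / (s : ℂ) with hξ
  have hnξ : ∀ x, ‖ξ x‖ ^ 2 = ‖c x‖ ^ 2 / f := by
    intro x
    rw [hξ]; simp only [norm_div, Complex.norm_real, Real.norm_eq_abs, abs_of_pos hsp, div_pow]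
    rw [← hss]; ring
  have hsumξ : ∑ x, ‖ξ x‖ ^ 2 = 1 := by
    simp_rw [hnξ, ← Finset.sum_div]
    exact div_self hfp.ne'
  have hW : ∀ x, (ξ x • T) * (ξ x • T)ᴴ = ((‖ξ x‖ ^ 2 : ℝ) : ℂ) • (T * Tᴴ) := by
    intro x
    rw [Matrix.conjTranspose_smul, Matrix.smul_mul, Matrix.mul_smul, smul_smul]
    congr 1
    have := Complex.mul_conj (ξ x)
    rw [Complex.normSq_eq_norm_sq] at this
    exact this
  have hcross : ∀ x, (star (ξ x) * (Tᴴ * Tx x).trace).re = ‖c x‖ ^ 2 / s := by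
    intro x
    change (star (ξ x) * c x).re = _
    have h1 : star (ξ x) * c x = ((‖c x‖ ^ 2 / s : ℝ) : ℂ) := by
      have := Complex.mul_conj (c x)
      rw [Complex.normSq_eq_norm_sq] at this
      rw [Complex.ofReal_div, ← this, hξ]
      simp
      ring
    rw [h1, Complex.ofReal_re]
  have hcs : ∑ x, ‖c x‖ ^ 2 / s = s := by
    rw [← Finset.sum_div, ← hf, ← hss]; field_simp
  have hplus : ∑ x, fro (Tx x + ξ x • T) = 2 + 2 * s := by
    simp_rw [fro_add_smul, hT, hcross, Finset.sum_add_distrib, ← Finset.mul_sum, hcs, mul_one, hsumξ,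
      hTx]
    ring
  have hminus : ∑ x, fro (Tx x - ξ x • T) = 2 - 2 * s := by
    have : ∀ x, Tx x - ξ x • T = Tx x + (-ξ x) • T := fun x => by
      rw [neg_smul, sub_eq_add_neg]
    simp_rw [this, fro_add_smul, hT, star_neg, neg_mul, Complex.neg_re, norm_neg, hcross,
      Finset.sum_add_distrib, ← Finset.mul_sum, Finset.sum_neg_distrib, hcs, mul_one, hsumξ, hTx]
    ring
  have hn : ∑ x, traceNorm (Tx x * (Tx x)ᴴ - (ξ x • T) * (ξ x • T)ᴴ) ≤ 2 * √ε := by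
    refine (Finset.sum_le_sum fun x _ => traceNorm_le _ _).trans ?_
    refine (Real.sum_sqrt_mul_sqrt_le Finset.univ (fun x => fro_nonneg _)
      (fun x => fro_nonneg _)).trans ?_
    rw [hplus, hminus]
    have h0 : 0 ≤ 2 - 2 * s := by rw [← hminus]; exact Finset.sum_nonneg fun x _ => fro_nonneg _
    rw [← Real.sqrt_mul h0]
    have h1 : (2 - 2 * s) * (2 + 2 * s) = 2 ^ 2 * (1 - f) := by rw [← hss]; ring
    rw [h1, Real.sqrt_mul (by norm_num), Real.sqrt_sq (by norm_num)]
    have : 1 - f ≤ ε := by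
      have : 1 - ε ≤ f := hF
      linarith
    have := Real.sqrt_le_sqrt this
    linarith
  have hfin := afw (fun x => Tx x * (Tx x)ᴴ) (fun x => (ξ x • T) * (ξ x • T)ᴴ)
    (fun x => Matrix.posSemidef_self_mul_conjTranspose _)
    (fun x => Matrix.posSemidef_self_mul_conjTranspose _)
    (by simp_rw [← fro_eq]; exact hTx)
    (by
      simp_rw [hW, Matrix.trace_smul, smul_eq_mul, Complex.re_ofReal_mul, ← Finset.sum_mul,
        hsumξ, ← fro_eq, hT]
      norm_num) (√ε) hn
  refine le_trans (le_of_eq ?_) hfin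
  simp_rw [hW, St_smul hps.1, ← Finset.sum_mul, hsumξ, one_mul]

/-- Tensor power of a matrix. -/
noncomputable def piPow {ι κ : Type*} (N : ℕ) (M : Matrix ι κ ℂ) :
    Matrix (Fin N → ι) (Fin N → κ) ℂ :=
  Matrix.of fun f g => ∏ i, M (f i) (g i)

lemma piPow_mul {ι κ τ : Type*} [Fintype κ] [DecidableEq κ] (N : ℕ) (P : Matrix ι κ ℂ)
    (Q : Matrix κ τ ℂ) : piPow N (P * Q) = piPow N P * piPow N Q := by
  ext f g
  simp only [piPow, Matrix.of_apply, Matrix.mul_apply, ← Finset.prod_mul_distrib]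
  rw [Finset.prod_univ_sum, Fintype.piFinset_univ]

lemma piPow_conjTranspose {ι κ : Type*} (N : ℕ) (P : Matrix ι κ ℂ) :
    (piPow N P)ᴴ = piPow N Pᴴ := by
  ext f g
  simp [piPow, Matrix.conjTranspose_apply]

lemma piPow_diagonal {ι : Type*} [DecidableEq ι] (N : ℕ) (d : ι → ℂ) :
    piPow N (Matrix.diagonal d) = Matrix.diagonal (fun f : Fin N → ι => ∏ i, d (f i)) := by
  ext f g
  simp only [piPow, Matrix.of_apply]
  by_cases h : f = g
  · subst h; simp
  · rw [Matrix.diagonal_apply_ne _ h]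
    obtain ⟨i, hi⟩ := Function.ne_iff.1 h
    exact Finset.prod_eq_zero (Finset.mem_univ i) (Matrix.diagonal_apply_ne _ hi)

lemma piPow_one {ι : Type*} [DecidableEq ι] (N : ℕ) :
    piPow N (1 : Matrix ι ι ℂ) = 1 := by
  rw [← Matrix.diagonal_one, piPow_diagonal]
  simp

lemma sum_prod_one {ι : Type*} [Fintype ι] [DecidableEq ι] (d : ι → ℝ) (hd : ∑ i, d i = 1) (N : ℕ) :
    ∑ f : Fin N → ι, ∏ i, d (f i) = 1 := by
  have := Finset.prod_univ_sum (fun _ : Fin N => (Finset.univ : Finset ι)) (fun _ j => d j)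
  rw [Fintype.piFinset_univ] at this
  rw [← this]
  simp [hd]

lemma sum_negMulLog_pow {ι : Type*} [Fintype ι] [DecidableEq ι] (d : ι → ℝ) (hd : ∑ i, d i = 1)
    (N : ℕ) : ∑ f : Fin N → ι, negMulLog (∏ i, d (f i)) = N * ∑ i, negMulLog (d i) := by
  induction N with
  | zero => simp
  | succ N ih =>
    rw [← (Fin.consEquiv (fun _ : Fin (N + 1) => ι)).sum_comp, Fintype.sum_prod_type]
    simp only [Fin.consEquiv_apply, Fin.prod_univ_succ, Fin.cons_zero, Fin.cons_succ,
      negMulLog_mul, Finset.sum_add_distrib, ← Finset.sum_mul, ← Finset.mul_sum]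
    rw [sum_prod_one d hd, ih, hd]
    push_cast
    ring

lemma S0_piPow {ι : Type*} [Fintype ι] [DecidableEq ι] {M : Matrix ι ι ℂ} (h : M.IsHermitian)
    (ht : M.trace.re = 1) (N : ℕ) : S0 (piPow N M) = N * S0 M := by
  obtain ⟨U, hU1, hU2, hM⟩ := spectral h
  have ht' : ∑ i, h.eigenvalues i = 1 := by
    rw [← ht, h.trace_eq_sum_eigenvalues]; simp
  have h1 : piPow N M = piPow N U *
      Matrix.diagonal (fun f : Fin N → ι => ((∏ i, h.eigenvalues (f i) : ℝ) : ℂ)) *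
        (piPow N U)ᴴ := by
    conv_lhs => rw [hM]
    rw [piPow_mul, piPow_mul, piPow_diagonal, piPow_conjTranspose]
    simp
  rw [h1, S0_conj, sum_negMulLog_pow _ ht', S0_hermitian h]
  rw [piPow_conjTranspose, ← piPow_mul, hU1, piPow_one]

lemma S0_kron {ι : Type*} [Fintype ι] [DecidableEq ι] {M : Matrix ι ι ℂ} (h : M.IsHermitian)
    (ht : M.trace.re = 1) (L : ℕ) (hL : 0 < L) :
    S0 (M ⊗ₖ ((L : ℂ)⁻¹ • (1 : Matrix (Fin L) (Fin L) ℂ))) = S0 M + log L := by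
  obtain ⟨U, hU1, hU2, hM⟩ := spectral h
  have ht' : ∑ i, h.eigenvalues i = 1 := by
    rw [← ht, h.trace_eq_sum_eigenvalues]; simp
  have h1 : M ⊗ₖ ((L : ℂ)⁻¹ • (1 : Matrix (Fin L) (Fin L) ℂ)) =
      (U ⊗ₖ (1 : Matrix (Fin L) (Fin L) ℂ)) *
      Matrix.diagonal (fun p : ι × Fin L => ((h.eigenvalues p.1 * (L : ℝ)⁻¹ : ℝ) : ℂ)) *
        (U ⊗ₖ (1 : Matrix (Fin L) (Fin L) ℂ))ᴴ := by
    have e : Matrix.diagonal (fun p : ι × Fin L => ((h.eigenvalues p.1 * (L : ℝ)⁻¹ : ℝ) : ℂ)) =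
        Matrix.diagonal (fun i => (h.eigenvalues i : ℂ)) ⊗ₖ
          Matrix.diagonal (fun _ : Fin L => (L : ℂ)⁻¹) := by
      rw [Matrix.diagonal_kronecker_diagonal]
      congr 1; funext p; simp
    rw [e, Matrix.conjTranspose_kronecker, ← Matrix.mul_kronecker_mul, ← Matrix.mul_kronecker_mul,
      ← hM, Matrix.smul_one_eq_diagonal]
    simp
  rw [h1, S0_conj]
  · rw [Fintype.sum_prod_type, S0_hermitian h]
    simp only [negMulLog_mul, Finset.sum_const, Finset.card_univ, Fintype.card_fin, nsmul_eq_mul]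
    have hL' : (L : ℝ) ≠ 0 := by exact_mod_cast hL.ne'
    have h2 : negMulLog ((L : ℝ)⁻¹) = (L : ℝ)⁻¹ * log L := by simp [negMulLog]
    rw [h2, ← Finset.mul_sum, Finset.sum_add_distrib, ← Finset.mul_sum, ← Finset.sum_mul, ht']
    field_simp
  · rw [Matrix.conjTranspose_kronecker, ← Matrix.mul_kronecker_mul, hU1]
    simp

lemma pure_vec {ι : Type*} [Fintype ι] [DecidableEq ι] {ψ : Matrix ι ι ℂ} (h : IsPure ψ) :
    ∃ v : ι → ℂ, ψ = Matrix.vecMulVec v (star v) ∧ ∑ i, ‖v i‖ ^ 2 = 1 := by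
  obtain ⟨⟨hps, htr⟩, hidem⟩ := h
  obtain ⟨U, hU1, hU2, hM⟩ := spectral hps.1
  have hsum : ∑ i, hps.1.eigenvalues i = 1 := by
    have := congrArg Complex.re htr
    rw [hps.1.trace_eq_sum_eigenvalues] at this
    simpa using this
  set lam := hps.1.eigenvalues with hlam
  have hD : Uᴴ * ψ * U = Matrix.diagonal (fun i => (lam i : ℂ)) := by
    rw [hM, ← Matrix.mul_assoc, ← Matrix.mul_assoc, hU1, Matrix.one_mul, Matrix.mul_assoc, hU1,
      Matrix.mul_one]
  have hDD : Matrix.diagonal (fun i => (lam i : ℂ)) * Matrix.diagonal (fun i => (lam i : ℂ)) =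
      Matrix.diagonal (fun i => (lam i : ℂ)) := by
    rw [← hD]
    calc Uᴴ * ψ * U * (Uᴴ * ψ * U) = Uᴴ * ψ * (U * Uᴴ) * ψ * U := by
          simp only [Matrix.mul_assoc]
      _ = Uᴴ * ψ * U := by rw [hU2, Matrix.mul_one, Matrix.mul_assoc Uᴴ, hidem]
  have h01 : ∀ i, lam i = 0 ∨ lam i = 1 := by
    intro i
    have := congrFun (congrFun hDD i) i
    rw [Matrix.diagonal_mul_diagonal] at this
    simp only [Matrix.diagonal_apply_eq] at this
    have h2 : lam i * lam i = lam i := by exact_mod_cast this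
    have h3 : lam i * (lam i - 1) = 0 := by linarith
    rcases mul_eq_zero.1 h3 with h | h
    · exact Or.inl h
    · exact Or.inr (by linarith)
  obtain ⟨i0, hi0⟩ : ∃ i0, lam i0 ≠ 0 := by
    by_contra hcon
    push Not at hcon
    simp [hcon] at hsum
  have hi1 : lam i0 = 1 := (h01 i0).resolve_left hi0
  have hoth : ∀ i, i ≠ i0 → lam i = 0 := by
    intro i hi
    have h2 : ∑ i ∈ Finset.univ.erase i0, lam i = 0 := by
      have := Finset.add_sum_erase Finset.univ lam (Finset.mem_univ i0)
      linarith
    exact (Finset.sum_eq_zero_iff_of_nonneg (fun i _ => hps.eigenvalues_nonneg i)).1 h2 i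
      (Finset.mem_erase.2 ⟨hi, Finset.mem_univ _⟩)
  refine ⟨fun i => U i i0, ?_, ?_⟩
  · ext a b
    conv_lhs => rw [hM]
    rw [Matrix.mul_apply, Finset.sum_eq_single i0]
    · simp [Matrix.mul_diagonal, hi1, Matrix.vecMulVec_apply]
    · intro j _ hj
      simp [Matrix.mul_diagonal, hoth j hj]
    · simp
  · have := congrArg Complex.re (congrFun (congrFun hU1 i0) i0)
    simp only [Matrix.mul_apply, Matrix.conjTranspose_apply, Complex.re_sum,
      Matrix.one_apply_eq, Complex.one_re] at this
    rw [← this]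
    refine Finset.sum_congr rfl fun j _ => ?_
    rw [← Complex.normSq_eq_norm_sq]
    simp [Complex.normSq_apply]

lemma sum_mul_star {ι : Type*} [Fintype ι] (v : ι → ℂ) :
    ∑ i, v i * star (v i) = ((∑ i, ‖v i‖ ^ 2 : ℝ) : ℂ) := by
  rw [Complex.ofReal_sum]
  refine Finset.sum_congr rfl fun i _ => ?_
  have := Complex.mul_conj (v i)
  rw [Complex.normSq_eq_norm_sq] at this
  exact this

lemma vec_pure {ι : Type*} [Fintype ι] [DecidableEq ι] (v : ι → ℂ) (hv : ∑ i, ‖v i‖ ^ 2 = 1) :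
    IsPure (Matrix.vecMulVec v (star v)) := by
  have h1 : v ⬝ᵥ star v = 1 := by
    have := sum_mul_star v
    rw [hv] at this
    simpa [dotProduct] using this
  refine ⟨⟨Matrix.posSemidef_vecMulVec_self_star v, ?_⟩, ?_⟩
  · rw [Matrix.trace_vecMulVec, h1]
  · rw [Matrix.vecMulVec_mul_vecMulVec, dotProduct_comm, h1]
    simp

/-- Trace distance controls the fidelity with a pure state. -/
lemma fidelity_bound {ι κ : Type*} [Fintype ι] [DecidableEq ι] [Fintype κ]
    (t : ι → ℂ) (tx : κ → ι → ℂ) (ht : ∑ i, ‖t i‖ ^ 2 = 1)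
    (htx : ∑ x, ∑ i, ‖tx x i‖ ^ 2 = 1) (ε : ℝ)
    (h : (1 / 2 : ℝ) * traceNorm (Matrix.vecMulVec t (star t) -
      ∑ x, Matrix.vecMulVec (tx x) (star (tx x))) ≤ ε) :
    1 - ε ≤ ∑ x, ‖star t ⬝ᵥ tx x‖ ^ 2 := by
  set Δ := Matrix.vecMulVec t (star t) - ∑ x, Matrix.vecMulVec (tx x) (star (tx x)) with hΔ
  have hH : Δ.IsHermitian := by
    refine (Matrix.posSemidef_vecMulVec_self_star t).1.sub ?_
    exact (Matrix.posSemidef_sum _ fun x _ => Matrix.posSemidef_vecMulVec_self_star (tx x)).1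
  have hn : ∀ v : ι → ℂ, v ⬝ᵥ star v = ((∑ i, ‖v i‖ ^ 2 : ℝ) : ℂ) := fun v => sum_mul_star v
  have htr : Δ.trace.re = 0 := by
    rw [hΔ, Matrix.trace_sub, Matrix.trace_sum]
    simp_rw [Matrix.trace_vecMulVec, hn]
    rw [← Complex.ofReal_sum, htx, ht]
    simp
  obtain ⟨U, hU1, hU2, hM⟩ := spectral hH
  rw [traceNorm, dif_pos hH] at h
  have hsum : ∑ i, hH.eigenvalues i = 0 := by
    rw [← htr, hH.trace_eq_sum_eigenvalues]; simp
  set s := Uᴴ *ᵥ t with hs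
  have hs1 : ∑ i, ‖s i‖ ^ 2 = 1 := by
    have h1 : star s ⬝ᵥ s = star t ⬝ᵥ t := by
      rw [hs, Matrix.star_mulVec, Matrix.conjTranspose_conjTranspose, ← Matrix.dotProduct_mulVec,
        Matrix.mulVec_mulVec, hU2, Matrix.one_mulVec]
    rw [dotProduct_comm, hn, dotProduct_comm, hn, ht] at h1
    exact_mod_cast h1
  have hq1 : (star t ⬝ᵥ (Δ *ᵥ t)).re = ∑ i, hH.eigenvalues i * ‖s i‖ ^ 2 := by
    have h1 : star t ⬝ᵥ (Δ *ᵥ t) =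
        star s ⬝ᵥ (Matrix.diagonal (fun i => (hH.eigenvalues i : ℂ)) *ᵥ s) := by
      conv_lhs => rw [hM]
      rw [hs, Matrix.star_mulVec, Matrix.conjTranspose_conjTranspose, ← Matrix.dotProduct_mulVec,
        Matrix.mulVec_mulVec, Matrix.mulVec_mulVec, Matrix.mul_assoc]
    rw [h1, dotProduct, Complex.re_sum]
    refine Finset.sum_congr rfl fun i _ => ?_
    rw [Matrix.mulVec_diagonal, ← Complex.normSq_eq_norm_sq]
    simp [Complex.normSq_apply]
    ring
  have hq2 : (star t ⬝ᵥ (Δ *ᵥ t)).re = 1 - ∑ x, ‖star t ⬝ᵥ tx x‖ ^ 2 := by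
    have hv : ∀ v : ι → ℂ, star t ⬝ᵥ (Matrix.vecMulVec v (star v) *ᵥ t) =
        ((‖star t ⬝ᵥ v‖ ^ 2 : ℝ) : ℂ) := by
      intro v
      have h2 : star v ⬝ᵥ t = star (star t ⬝ᵥ v) := by
        rw [Matrix.star_dotProduct]
      rw [Matrix.vecMulVec_mulVec, dotProduct_smul, h2]
      have := Complex.mul_conj (star t ⬝ᵥ v)
      rw [Complex.normSq_eq_norm_sq] at this
      rw [← this]
      simp
    rw [hΔ, Matrix.sub_mulVec, dotProduct_sub, Matrix.sum_mulVec, dotProduct_sum]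
    simp_rw [hv]
    have h3 : star t ⬝ᵥ t = 1 := by
      rw [dotProduct_comm, hn, ht]; simp
    rw [h3, ← Complex.ofReal_sum, ← Complex.ofReal_sub, Complex.ofReal_re]
    simp
  have hle : ∑ i, hH.eigenvalues i * ‖s i‖ ^ 2 ≤ ∑ i, (|hH.eigenvalues i| + hH.eigenvalues i) / 2 := by
    refine Finset.sum_le_sum fun i _ => ?_
    have h1 : ‖s i‖ ^ 2 ≤ 1 := by
      rw [← hs1]
      exact Finset.single_le_sum (f := fun i => ‖s i‖ ^ 2) (fun i _ => by positivity)
        (Finset.mem_univ i)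
    have h0 : 0 ≤ ‖s i‖ ^ 2 := by positivity
    rcases le_total 0 (hH.eigenvalues i) with h2 | h2
    · rw [abs_of_nonneg h2]; nlinarith
    · rw [abs_of_nonpos h2]; nlinarith
  rw [← Finset.sum_div, Finset.sum_add_distrib, hsum] at hle
  linarith

lemma conj_vec {ι κ : Type*} [Fintype ι] [Fintype κ] (X : Matrix κ ι ℂ) (v : ι → ℂ) :
    X * Matrix.vecMulVec v (star v) * Xᴴ = Matrix.vecMulVec (X *ᵥ v) (star (X *ᵥ v)) := by
  rw [Matrix.mul_vecMulVec, Matrix.vecMulVec_mul, Matrix.star_mulVec]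

lemma kron_vec {ι κ : Type*} (u : ι → ℂ) (w : κ → ℂ) :
    Matrix.vecMulVec u (star u) ⊗ₖ Matrix.vecMulVec w (star w) =
      Matrix.vecMulVec (fun p : ι × κ => u p.1 * w p.2) (star fun p : ι × κ => u p.1 * w p.2) := by
  ext p q
  simp [Matrix.vecMulVec_apply, Matrix.kroneckerMap_apply]
  ring

/-- Scaled identity: the maximally entangled vector as a matrix. -/
noncomputable def mes (L : ℕ) : Matrix (Fin L) (Fin L) ℂ := (((√(L : ℝ))⁻¹ : ℝ) : ℂ) • 1

lemma mes_mul (L : ℕ) : mes L * (mes L)ᴴ = (L : ℂ)⁻¹ • 1 := by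
  rw [mes, Matrix.conjTranspose_smul, Matrix.smul_mul, Matrix.mul_smul, smul_smul]
  simp only [Matrix.conjTranspose_one, Matrix.mul_one]
  congr 1
  have : star ((((√(L : ℝ))⁻¹ : ℝ) : ℂ)) = (((√(L : ℝ))⁻¹ : ℝ) : ℂ) := Complex.conj_ofReal _
  rw [this, ← Complex.ofReal_mul, ← mul_inv, Real.mul_self_sqrt (Nat.cast_nonneg L)]
  simp

lemma phiRank_vec (L : ℕ) : phiRank L =
    Matrix.vecMulVec (fun p : Fin L × Fin L => mes L p.1 p.2)
      (star fun p : Fin L × Fin L => mes L p.1 p.2) := by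
  have hs : (((√(L : ℝ))⁻¹ : ℝ) : ℂ) * (((√(L : ℝ))⁻¹ : ℝ) : ℂ) = (L : ℂ)⁻¹ := by
    rw [← Complex.ofReal_mul, ← mul_inv, Real.mul_self_sqrt (Nat.cast_nonneg L)]
    simp
  ext p q
  have hst : star ((((√(L : ℝ))⁻¹ : ℝ) : ℂ)) = (((√(L : ℝ))⁻¹ : ℝ) : ℂ) := Complex.conj_ofReal _
  simp only [phiRank, mes, Matrix.vecMulVec_apply, Matrix.smul_apply, Matrix.of_apply, Pi.star_apply,
    Matrix.one_apply, smul_eq_mul, ← hs]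
  by_cases h1 : p.1 = p.2 <;> by_cases h2 : q.1 = q.2 <;> simp [h1, h2]

lemma fro_submatrix_left {X X' Y : Type*} [Fintype X] [Fintype X'] [Fintype Y]
    (e : X' ≃ X) (Z : Matrix X Y ℂ) : fro (Z.submatrix e id) = fro Z := by
  simp only [fro, Matrix.submatrix_apply, id]
  exact e.sum_comp (fun i => ∑ j, ‖Z i j‖ ^ 2)

lemma fro_kron_mes {X Y : Type*} [Fintype X] [DecidableEq X] [Fintype Y] [DecidableEq Y]
    (Z : Matrix X Y ℂ) (L : ℕ) (hL : 0 < L) : fro (Z ⊗ₖ mes L) = fro Z := by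
  have hL' : (L : ℂ) ≠ 0 := by exact_mod_cast hL.ne'
  rw [fro_eq, fro_eq, Matrix.conjTranspose_kronecker, ← Matrix.mul_kronecker_mul, mes_mul,
    Matrix.trace_kronecker, Matrix.trace_smul, Matrix.trace_one]
  simp [hL']

lemma fro_piPow {X Y : Type*} [Fintype X] [DecidableEq X] [Fintype Y] [DecidableEq Y]
    (N : ℕ) (Z : Matrix X Y ℂ) (hZ : fro Z = 1) : fro (piPow N Z) = 1 := by
  have h := sum_prod_one (fun p : X × Y => ‖Z p.1 p.2‖ ^ 2)
    (by rw [Fintype.sum_prod_type]; exact hZ) N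
  rw [← h, fro, ← Fintype.sum_prod_type',
    ← (Equiv.arrowProdEquivProdArrow (Fin N) (fun _ => X) (fun _ => Y)).sum_comp]
  refine Finset.sum_congr rfl fun f _ => ?_
  simp [piPow, Finset.prod_pow]

lemma isoPow_eq {A B E : Type*} [Fintype A] [Fintype B] [Fintype E] (N : ℕ)
    (V : Matrix (B × E) A ℂ) : isoPow N V =
      (piPow N V).submatrix (Equiv.arrowProdEquivProdArrow (Fin N) (fun _ => B) (fun _ => E)).symm id := by
  ext be a
  rfl

lemma isoPow_isometry {A B E : Type*} [Fintype A] [DecidableEq A] [Fintype B] [DecidableEq B]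
    [Fintype E] [DecidableEq E] (N : ℕ) (V : Matrix (B × E) A ℂ) (hV : Vᴴ * V = 1) :
    (isoPow N V)ᴴ * isoPow N V = 1 := by
  rw [isoPow_eq, Matrix.conjTranspose_submatrix, Matrix.submatrix_mul_equiv, piPow_conjTranspose,
    ← piPow_mul, hV, piPow_one]
  simp

/-- The output vector of the isometry, seen as a matrix with rows `R × B` and columns `E`. -/
noncomputable def shift {R B E : Type*} (P : Matrix R (B × E) ℂ) : Matrix (R × B) E ℂ :=
  Matrix.of fun p e => P p.1 (p.2, e)

lemma fro_shift {R B E : Type*} [Fintype R] [Fintype B] [Fintype E] (P : Matrix R (B × E) ℂ) :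
    fro (shift P) = fro P := by
  simp [fro, shift, Fintype.sum_prod_type]

lemma fro_isometry {R A Y : Type*} [Fintype R] [Fintype A] [DecidableEq A] [Fintype Y]
    (W : Matrix R A ℂ) (V : Matrix Y A ℂ) (hV : Vᴴ * V = 1) :
    (W * Vᵀ) * (W * Vᵀ)ᴴ = W * Wᴴ := by
  have h := locc_step1 (κ := Unit) W (fun _ => V) (by simpa using hV)
  simpa using h

lemma ideal_eq {A B E : Type} [Fintype A] [DecidableEq A]
    [Fintype B] [DecidableEq B] [Fintype E] [DecidableEq E]
    (N L : ℕ) (V : Matrix (B × E) A ℂ) (W : Matrix (Fin N → A) (Fin N → A) ℂ)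
    (t : ((Fin N → A) × ((Fin N → B) × (Fin N → E))) × (Fin L × Fin L) → ℂ)
    (ht : ∀ s, t s = ((W * (isoPow N V)ᵀ) ⊗ₖ mes L) (s.1.1, s.2.1) (s.1.2, s.2.2)) :
    idealOut N L V (Matrix.vecMulVec (fun p => W p.1 p.2) (star fun p => W p.1 p.2)) =
      Matrix.vecMulVec t (star t) := by
  rw [idealOut, conj_vec, phiRank_vec, kron_vec]
  have : t = fun p => (((1 : Matrix (Fin N → A) (Fin N → A) ℂ) ⊗ₖ isoPow N V) *ᵥ
      (fun p => W p.1 p.2)) p.1 * mes L p.2.1 p.2.2 := by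
    funext s
    rw [ht, Matrix.kroneckerMap_apply]
    congr 1
    symm
    simp only [Matrix.mul_apply, Matrix.mulVec, dotProduct, Fintype.sum_prod_type,
      Matrix.kroneckerMap_apply, Matrix.one_apply, Matrix.transpose_apply, ite_mul, one_mul, zero_mul]
    rw [Finset.sum_eq_single s.1.1]
    · simp [mul_comm]
    · intro b _ hb
      simp [hb.symm]
    · simp
  rw [this]

lemma actual_eq {A B E M ι κ : Type} [Fintype A] [DecidableEq A]
    [Fintype B] [DecidableEq B] [Fintype E] [DecidableEq E]
    [Fintype M] [Fintype ι] [Fintype κ]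
    (N K L : ℕ) (V : Matrix (B × E) A ℂ) (out : ι → M)
    (F : ι → Matrix (Fin L) ((Fin N → B) × Fin K) ℂ)
    (G : M → κ → Matrix (((Fin N → B) × (Fin N → E)) × Fin L) ((Fin N → E) × Fin K) ℂ)
    (W : Matrix (Fin N → A) (Fin N → A) ℂ)
    (T0 : Matrix ((Fin N → A) × ((Fin N → B) × Fin K)) ((Fin N → E) × Fin K) ℂ)
    (hT0 : ∀ r b k e k', T0 (r, (b, k)) (e, k') = (W * (isoPow N V)ᵀ) r (b, e) * mes K k k')
    (tx : ι × κ → ((Fin N → A) × ((Fin N → B) × (Fin N → E))) × (Fin L × Fin L) → ℂ)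
    (htx : ∀ x s, tx x s = (((1 : Matrix (Fin N → A) (Fin N → A) ℂ) ⊗ₖ F x.1) * T0 *
      (G (out x.1) x.2)ᵀ) (s.1.1, s.2.1) (s.1.2, s.2.2)) :
    actualOut N K L V out F G (Matrix.vecMulVec (fun p => W p.1 p.2) (star fun p => W p.1 p.2)) =
      ∑ x, Matrix.vecMulVec (tx x) (star (tx x)) := by
  rw [actualOut, conj_vec, phiRank_vec, kron_vec]
  have hsub : ∀ {α β : Type} (e : β → α) (v : α → ℂ), (Matrix.vecMulVec v (star v)).submatrix e e =
      Matrix.vecMulVec (v ∘ e) (star (v ∘ e)) := fun e v => rfl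
  rw [hsub]
  simp_rw [conj_vec]
  rw [Fintype.sum_prod_type]
  ext s s'
  simp only [Matrix.submatrix_apply, Matrix.sum_apply]
  refine Finset.sum_congr rfl fun i _ => Finset.sum_congr rfl fun k _ => ?_
  have key : ∀ s : ((Fin N → A) × ((Fin N → B) × (Fin N → E))) × (Fin L × Fin L), tx (i, k) s =
      (((1 : Matrix (Fin N → A) (Fin N → A) ℂ) ⊗ₖ (F i ⊗ₖ G (out i) k)) *ᵥ
        ((fun p : ((Fin N → A) × ((Fin N → B) × (Fin N → E))) × (Fin K × Fin K) =>
          (((1 : Matrix (Fin N → A) (Fin N → A) ℂ) ⊗ₖ isoPow N V) *ᵥ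
          (fun p => W p.1 p.2)) p.1 * mes K p.2.1 p.2.2) ∘
          (fun t : (Fin N → A) × (((Fin N → B) × Fin K) × ((Fin N → E) × Fin K)) =>
            ((t.1, (t.2.1.1, t.2.2.1)), (t.2.1.2, t.2.2.2))))) (s.1.1, (s.2.1, (s.1.2, s.2.2))) := by
    intro s
    have h1 : ∀ r be, (((1 : Matrix (Fin N → A) (Fin N → A) ℂ) ⊗ₖ isoPow N V) *ᵥ
          (fun p => W p.1 p.2)) (r, be) = (W * (isoPow N V)ᵀ) r be := by
      intro r be
      simp only [Matrix.mul_apply, Matrix.mulVec, dotProduct, Fintype.sum_prod_type,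
        Matrix.kroneckerMap_apply, Matrix.one_apply, Matrix.transpose_apply, ite_mul, one_mul, zero_mul]
      rw [Finset.sum_eq_single r]
      · simp [mul_comm]
      · intro b _ hb
        simp [hb.symm]
      · simp
    have h2 : ((fun p : ((Fin N → A) × ((Fin N → B) × (Fin N → E))) × (Fin K × Fin K) =>
          (((1 : Matrix (Fin N → A) (Fin N → A) ℂ) ⊗ₖ isoPow N V) *ᵥ
          (fun p => W p.1 p.2)) p.1 * mes K p.2.1 p.2.2) ∘
          (fun t : (Fin N → A) × (((Fin N → B) × Fin K) × ((Fin N → E) × Fin K)) =>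
            ((t.1, (t.2.1.1, t.2.2.1)), (t.2.1.2, t.2.2.2)))) =
        fun t => T0 (t.1, t.2.1) t.2.2 := by
      funext t
      simp only [Function.comp]
      rw [h1, ← hT0]
    rw [h2, htx]
    have h3 : ∀ (r : Fin N → A) (l : Fin L) (y : (Fin N → E) × Fin K),
        (((1 : Matrix (Fin N → A) (Fin N → A) ℂ) ⊗ₖ F i) * T0) (r, l) y =
          ∑ x, F i l x * T0 (r, x) y := by
      intro r l y
      rw [Matrix.mul_apply, Fintype.sum_prod_type, Finset.sum_eq_single r]
      · simp [Matrix.kroneckerMap_apply]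
      · intro b _ hb
        simp [Matrix.kroneckerMap_apply, hb.symm]
      · simp
    rw [Matrix.mul_apply]
    simp only [h3]
    simp only [Matrix.mulVec, dotProduct]
    symm
    rw [Fintype.sum_prod_type, Finset.sum_eq_single s.1.1]
    · rw [Fintype.sum_prod_type, Finset.sum_comm]
      refine Finset.sum_congr rfl fun y _ => ?_
      rw [Finset.sum_mul]
      refine Finset.sum_congr rfl fun x _ => ?_
      simp [Matrix.kroneckerMap_apply]
      ring
    · intro b _ hb
      simp [Matrix.kroneckerMap_apply, hb.symm]
    · simp
  simp only [Matrix.vecMulVec_apply, Pi.star_apply, key]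

lemma sum_vec_eq_fro {R Z C D : Type*} [Fintype R] [Fintype Z] [Fintype C] [Fintype D]
    (T : Matrix (R × C) (Z × D) ℂ) (t : (R × Z) × (C × D) → ℂ)
    (ht : ∀ s, t s = T (s.1.1, s.2.1) (s.1.2, s.2.2)) :
    ∑ s, ‖t s‖ ^ 2 = fro T := by
  simp only [fro, ht, Fintype.sum_prod_type]
  exact Finset.sum_congr rfl fun r _ => Finset.sum_comm

lemma sum_vec_eq_trace {R Z C D : Type*} [Fintype R] [Fintype Z] [Fintype C] [Fintype D]
    (T T' : Matrix (R × C) (Z × D) ℂ) (t t' : (R × Z) × (C × D) → ℂ)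
    (ht : ∀ s, t s = T (s.1.1, s.2.1) (s.1.2, s.2.2))
    (ht' : ∀ s, t' s = T' (s.1.1, s.2.1) (s.1.2, s.2.2)) :
    star t ⬝ᵥ t' = (Tᴴ * T').trace := by
  have h : (Tᴴ * T').trace = ∑ i, ∑ j, star (T i j) * T' i j := by
    rw [Matrix.trace, Finset.sum_comm]
    simp [Matrix.mul_apply]
  rw [h]
  simp only [dotProduct, Pi.star_apply, ht, ht', Fintype.sum_prod_type]
  exact Finset.sum_congr rfl fun r _ => Finset.sum_comm

/-- The n-letter converse bound in nats for a fixed i.i.d. input. -/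
lemma core {A B E M ι κ : Type}
    [Fintype A] [DecidableEq A] [Nonempty A] [Fintype B] [DecidableEq B]
    [Fintype E] [DecidableEq E] [Fintype M] [Fintype ι] [Fintype κ]
    (N K L : ℕ) (hK : 0 < K) (hL : 0 < L)
    (ε : ℝ) (hε1 : ε ≤ 1)
    (V : Matrix (B × E) A ℂ) (hV : Vᴴ * V = 1)
    (out : ι → M)
    (F : ι → Matrix (Fin L) ((Fin N → B) × Fin K) ℂ) (hF : ∑ i, (F i)ᴴ * F i = 1)
    (G : M → κ → Matrix (((Fin N → B) × (Fin N → E)) × Fin L) ((Fin N → E) × Fin K) ℂ)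
    (hG : ∀ m, ∑ k, (G m k)ᴴ * G m k = 1)
    (hprot : ∀ ψ : Matrix ((Fin N → A) × (Fin N → A)) ((Fin N → A) × (Fin N → A)) ℂ,
      IsPure ψ →
      (1 / 2 : ℝ) * traceNorm (idealOut N L V ψ - actualOut N K L V out F G ψ) ≤ ε)
    (W : Matrix A A ℂ) (hW : fro W = 1) :
    N * S0 (W * Wᴴ) + log L ≤ N * S0 (shift (W * Vᵀ) * (shift (W * Vᵀ))ᴴ) + log K +
      √ε * (N * log (Fintype.card A) + log L) + gN √ε := by
  set Wn := piPow N W with hWn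
  set Vn := isoPow N V with hVn
  have hVni : Vnᴴ * Vn = 1 := isoPow_isometry N V hV
  have hfWn : fro Wn = 1 := fro_piPow N W hW
  set Pn := Wn * Vnᵀ with hPn
  have hPP : Pn * Pnᴴ = Wn * Wnᴴ := fro_isometry Wn Vn hVni
  have hfPn : fro Pn = 1 := by rw [fro_eq, hPP, ← fro_eq, hfWn]
  set T := Pn ⊗ₖ mes L with hT
  have hfT : fro T = 1 := by rw [hT, fro_kron_mes _ _ hL, hfPn]
  set T0 : Matrix ((Fin N → A) × ((Fin N → B) × Fin K)) ((Fin N → E) × Fin K) ℂ :=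
    (shift Pn ⊗ₖ mes K).submatrix (Equiv.prodAssoc _ _ _).symm id with hT0
  have hfT0 : fro T0 = 1 := by
    rw [hT0, fro_submatrix_left, fro_kron_mes _ _ hK, fro_shift, hfPn]
  set P : ι → Matrix ((Fin N → A) × Fin L) ((Fin N → A) × ((Fin N → B) × Fin K)) ℂ :=
    fun i => (1 : Matrix (Fin N → A) (Fin N → A) ℂ) ⊗ₖ F i with hP
  have hPs : ∑ i, (P i)ᴴ * P i = 1 := by
    have : ∀ i, (P i)ᴴ * P i = (1 : Matrix (Fin N → A) (Fin N → A) ℂ) ⊗ₖ ((F i)ᴴ * F i) := by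
      intro i
      rw [hP]
      simp only [Matrix.conjTranspose_kronecker, ← Matrix.mul_kronecker_mul]
      simp
    simp_rw [this]
    rw [← Matrix.one_kronecker_one, ← hF]
    ext p q
    simp [Matrix.sum_apply, Matrix.kroneckerMap_apply, Finset.mul_sum]
  set Tx : ι × κ → Matrix ((Fin N → A) × Fin L) (((Fin N → B) × (Fin N → E)) × Fin L) ℂ :=
    fun x => P x.1 * T0 * (G (out x.1) x.2)ᵀ with hTx
  have hmono := locc_mono T0 P hPs (fun i k => G (out i) k) (fun i => hG (out i))
  have htrace := locc_trace T0 P hPs (fun i k => G (out i) k) (fun i => hG (out i))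
  have hfTx : ∑ x, fro (Tx x) = 1 := by
    rw [Fintype.sum_prod_type]
    have := congrArg Complex.re htrace
    simp only [Complex.re_sum, ← fro_eq] at this
    rw [hfT0] at this
    exact this
  set t : ((Fin N → A) × ((Fin N → B) × (Fin N → E))) × (Fin L × Fin L) → ℂ :=
    fun s => T (s.1.1, s.2.1) (s.1.2, s.2.2) with ht
  set tx : ι × κ → ((Fin N → A) × ((Fin N → B) × (Fin N → E))) × (Fin L × Fin L) → ℂ :=
    fun x s => Tx x (s.1.1, s.2.1) (s.1.2, s.2.2) with htx
  have hfid : 1 - ε ≤ ∑ x, ‖(Tᴴ * Tx x).trace‖ ^ 2 := by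
    have hpure := hprot _ (vec_pure (fun p => Wn p.1 p.2)
      (by rw [Fintype.sum_prod_type]; exact hfWn))
    rw [ideal_eq N L V Wn t (fun s => rfl),
      actual_eq N K L V out F G Wn T0 (fun r b k e k' => rfl) tx (fun x s => rfl)] at hpure
    have := fidelity_bound t tx (by rw [sum_vec_eq_fro T t (fun s => rfl), hfT])
      (by
        rw [← hfTx]
        exact Finset.sum_congr rfl fun x _ => sum_vec_eq_fro (Tx x) (tx x) (fun s => rfl)) ε hpure
    refine this.trans (le_of_eq (Finset.sum_congr rfl fun x _ => ?_))
    rw [sum_vec_eq_trace T (Tx x) t (tx x) (fun s => rfl) (fun s => rfl)]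
  have hcont := continuity_bound T Tx hfT hfTx ε hε1 hfid
  rw [Fintype.sum_prod_type] at hcont
  have hWH := (Matrix.posSemidef_self_mul_conjTranspose W).1
  have hWnWn : Wn * Wnᴴ = piPow N (W * Wᴴ) := by
    rw [hWn, piPow_conjTranspose, ← piPow_mul]
  have hST : S0 (T * Tᴴ) = N * S0 (W * Wᴴ) + log L := by
    rw [hT, Matrix.conjTranspose_kronecker, ← Matrix.mul_kronecker_mul, mes_mul, hPP,
      S0_kron (Matrix.posSemidef_self_mul_conjTranspose Wn).1 (by rw [← fro_eq, hfWn]) L hL, hWnWn,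
      S0_piPow hWH (by rw [← fro_eq, hW])]
  set Q := shift (W * Vᵀ) with hQ
  have hfQ : fro Q = 1 := by
    rw [hQ, fro_shift, fro_eq, fro_isometry W V hV, ← fro_eq, hW]
  have hshift : shift Pn = (piPow N Q).submatrix
      (Equiv.arrowProdEquivProdArrow (Fin N) (fun _ => A) (fun _ => B)).symm id := by
    ext p e
    have h1 : Pn p.1 (p.2, e) = piPow N (W * Vᵀ) p.1 (fun i => (p.2 i, e i)) := by
      rw [piPow_mul]
      rfl
    change Pn p.1 (p.2, e) = _
    rw [h1]
    rfl
  have hQH := (Matrix.posSemidef_self_mul_conjTranspose Q).1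
  have hSsh : S0 (shift Pn * (shift Pn)ᴴ) = N * S0 (Q * Qᴴ) := by
    rw [hshift, Matrix.conjTranspose_submatrix,
      show (id : (Fin N → E) → (Fin N → E)) = Equiv.refl _ from rfl,
      Matrix.submatrix_mul_equiv, S0_submatrix, piPow_conjTranspose, ← piPow_mul,
      S0_piPow hQH (by rw [← fro_eq, hfQ])]
  have hST0 : St (T0 * T0ᴴ) = N * S0 (Q * Qᴴ) + log K := by
    rw [St, ← fro_eq, hfT0, negMulLog_one, sub_zero, hT0, Matrix.conjTranspose_submatrix,
      show (id : ((Fin N → E) × Fin K) → ((Fin N → E) × Fin K)) = Equiv.refl _ from rfl,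
      Matrix.submatrix_mul_equiv, S0_submatrix, Matrix.conjTranspose_kronecker,
      ← Matrix.mul_kronecker_mul, mes_mul,
      S0_kron (Matrix.posSemidef_self_mul_conjTranspose _).1
        (by rw [← fro_eq, fro_shift, hfPn]) K hK, hSsh]
  have hcard : log (Fintype.card ((Fin N → A) × Fin L)) = N * log (Fintype.card A) + log L := by
    have hA : (Fintype.card A : ℝ) ≠ 0 := by exact_mod_cast Fintype.card_ne_zero
    have hL' : (L : ℝ) ≠ 0 := by exact_mod_cast hL.ne'
    simp only [Fintype.card_prod, Fintype.card_fun, Fintype.card_fin, Nat.cast_mul, Nat.cast_pow]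
    rw [log_mul (pow_ne_zero _ hA) hL', log_pow]
  rw [hST, hcard] at hcont
  rw [hST0] at hmono
  linarith

lemma ext_eq {A B E : Type} [Fintype A] [DecidableEq A] [Fintype B] [DecidableEq B]
    [Fintype E] [DecidableEq E] (V : Matrix (B × E) A ℂ) (W : Matrix A A ℂ) :
    ext (fun X : Matrix A A ℂ => ptR (V * X * Vᴴ))
      (Matrix.vecMulVec (fun p : A × A => W p.1 p.2) (star fun p : A × A => W p.1 p.2)) =
      shift (W * Vᵀ) * (shift (W * Vᵀ))ᴴ := by
  ext p q
  simp only [ext, ptR, Matrix.of_apply]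
  rw [Matrix.mul_apply]
  refine Finset.sum_congr rfl fun e _ => ?_
  have h1 : (Matrix.of fun a a' => Matrix.vecMulVec (fun p : A × A => W p.1 p.2)
      (star fun p : A × A => W p.1 p.2) (p.1, a) (q.1, a')) =
      Matrix.vecMulVec (W p.1) (star (W q.1)) := rfl
  rw [h1, Matrix.mul_vecMulVec, Matrix.vecMulVec_mul, ← Matrix.star_mulVec,
    Matrix.vecMulVec_apply]
  simp only [shift, Matrix.of_apply, Matrix.conjTranspose_apply, Matrix.mulVec, dotProduct,
    Pi.star_apply, Matrix.mul_apply, Matrix.transpose_apply, mul_comm]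

lemma ptR_shift {R B E : Type} [Fintype R] [DecidableEq R] [Fintype B] [DecidableEq B]
    [Fintype E] [DecidableEq E] (P : Matrix R (B × E) ℂ) :
    ptR (shift P * (shift P)ᴴ) = P * Pᴴ := by
  ext i j
  simp [ptR, shift, Matrix.mul_apply, Fintype.sum_prod_type]

end Aux

/-- converse bound for quantum channel merging: any (n, L/K, ε) protocol
satisfies (1/n)[(1−√ε)log₂L − log₂K] ≤ H(N) + √ε log₂|A| + g₂(√ε). -/
theorem channel_merging_converse
    {A B E M ι κ : Type}
    [Fintype A] [DecidableEq A] [Nonempty A] [Fintype B] [DecidableEq B]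
    [Fintype E] [DecidableEq E] [Fintype M] [Fintype ι] [Fintype κ]
    (n K L : ℕ) (hn : 0 < n) (hK : 0 < K) (hL : 0 < L)
    (ε : ℝ) (hε0 : 0 ≤ ε) (hε1 : ε ≤ 1)
    (V : Matrix (B × E) A ℂ) (hV : Vᴴ * V = 1)
    (out : ι → M)
    (F : ι → Matrix (Fin L) ((Fin n → B) × Fin K) ℂ) (hF : ∑ i, (F i)ᴴ * F i = 1)
    (G : M → κ → Matrix (((Fin n → B) × (Fin n → E)) × Fin L) ((Fin n → E) × Fin K) ℂ)
    (hG : ∀ m, ∑ k, (G m k)ᴴ * G m k = 1)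
    (hprot : ∀ ψ : Matrix ((Fin n → A) × (Fin n → A)) ((Fin n → A) × (Fin n → A)) ℂ,
      IsPure ψ →
      (1 / 2 : ℝ) * traceNorm (idealOut n L V ψ - actualOut n K L V out F G ψ) ≤ ε) :
    (1 / n : ℝ) * ((1 - Real.sqrt ε) * Real.logb 2 L - Real.logb 2 K) ≤
      chEnt (fun X : Matrix A A ℂ => ptR (V * X * Vᴴ)) +
        Real.sqrt ε * Real.logb 2 (Fintype.card A) + g2 (Real.sqrt ε) := by
  have hln2 : (0 : ℝ) < Real.log 2 := Real.log_pos (by norm_num)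
  have hn' : (0 : ℝ) < n := by exact_mod_cast hn
  have hg : g2 (Real.sqrt ε) = gN (Real.sqrt ε) / Real.log 2 := by
    simp only [g2, gN, Real.logb, Real.negMulLog]
    rw [add_comm (1 : ℝ)]
    ring
  have hbound : ∀ x ∈ {x | ∃ ψ : Matrix (A × A) (A × A) ℂ, IsPure ψ ∧
      x = condEntB (ext (fun X : Matrix A A ℂ => ptR (V * X * Vᴴ)) ψ)},
      (1 / n : ℝ) * ((1 - Real.sqrt ε) * Real.logb 2 L - Real.logb 2 K) -
        (Real.sqrt ε * Real.logb 2 (Fintype.card A) + g2 (Real.sqrt ε)) ≤ x := by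
    rintro x ⟨ψ, hψ, rfl⟩
    obtain ⟨v, rfl, hv⟩ := pure_vec hψ
    have hW : fro (Matrix.of fun a b => v (a, b)) = 1 := by
      rw [← hv, Fintype.sum_prod_type]; rfl
    set W : Matrix A A ℂ := Matrix.of fun a b => v (a, b) with hWd
    have hvW : v = fun p : A × A => W p.1 p.2 := rfl
    have hcore := core n K L hK hL ε hε1 V hV out F hF G hG hprot W hW
    rw [hvW, ext_eq, condEntB, ptR_shift, fro_isometry W V hV,
      vnEntropy_eq (Matrix.posSemidef_self_mul_conjTranspose _).1,
      vnEntropy_eq (Matrix.posSemidef_self_mul_conjTranspose _).1, hg]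
    have hg0 : gN (Real.sqrt ε) ≤ n * gN (Real.sqrt ε) := by
      have h1 : (1 : ℝ) ≤ n := by exact_mod_cast hn
      have h2 : 0 ≤ gN (Real.sqrt ε) := gN_nonneg (Real.sqrt_nonneg _)
      nlinarith
    simp only [Real.logb]
    rw [← sub_nonneg]
    set a := S0 (shift (W * Vᵀ) * (shift (W * Vᵀ))ᴴ)
    set b := S0 (W * Wᴴ)
    have hkey : 0 ≤ (n * a + Real.log K +
      Real.sqrt ε * (n * Real.log (Fintype.card A) + Real.log L) + n * gN (Real.sqrt ε)
        - (n * b + Real.log L)) / (n * Real.log 2) :=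
      div_nonneg (by linarith) (by positivity)
    refine hkey.trans (le_of_eq ?_)
    field_simp
    ring
  have hne : {x | ∃ ψ : Matrix (A × A) (A × A) ℂ, IsPure ψ ∧
      x = condEntB (ext (fun X : Matrix A A ℂ => ptR (V * X * Vᴴ)) ψ)}.Nonempty := by
    obtain ⟨a⟩ := ‹Nonempty A›
    refine ⟨_, _, vec_pure (Pi.single (a, a) 1) ?_, rfl⟩
    rw [Finset.sum_eq_single (a, a)]
    · simp
    · intro b _ hb
      simp [Pi.single_eq_of_ne hb]
    · simp
  have := le_csInf hne hbound
  rw [chEnt]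
  linarith

end QCh
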